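/- Suppose u ∈ C(closure Ω̃) is harmonic in Ω̃, is C¹ on Ω̃ ∪ ∂D1 ∪ ∂D2, satisfies u + γ ∂_ν u = 0 on ∂D1 ∪ ∂D2, satisfies ∫_{∂D_j} ∂_ν u dH^{n−1} = 0 for j = 1, 2 (H^{n−1} denoting (n−1)-dimensional Hausdorff measure), and satisfies u(x) = x_1 for all x ∈ ∂Ω. Then there exist constants c > 0 and C > 0, depending only on n, γ, and μ (in particular independent of ε and u), such that sup_{x ∈ Ω_{c√ε}} |∇u(x)| ≥ (1/C) · ε^{(α−1)/2}. -/

import Mathlib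

open MeasureTheory Metric Set
open scoped RealInnerProductSpace ENNReal

noncomputable section

abbrev E (k : ℕ) := EuclideanSpace ℝ (Fin k)

/-- Laplacian: sum of pure second directional derivatives. -/
def elap {k : ℕ} (u : E k → ℝ) (x : E k) : ℝ :=
  ∑ i : Fin k, iteratedFDeriv ℝ 2 u x ![EuclideanSpace.single i 1, EuclideanSpace.single i 1]

/-- The horizontal part `x'` of `x = (x', x_n)`. -/
def epre {m : ℕ} (x : E (m+1)) : E m :=
  (EuclideanSpace.equiv (Fin m) ℝ).symm fun i => x i.castSucc

/-- The vertical (last) coordinate `x_n`. -/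
def lastC {m : ℕ} (x : E (m+1)) : ℝ := x (Fin.last m)

/-- Assemble the point `(p, t)`. -/
def eglue {m : ℕ} (p : E m) (t : ℝ) : E (m+1) :=
  (EuclideanSpace.equiv (Fin (m+1)) ℝ).symm fun i => Fin.lastCases t (fun j => p j) i

open Filter Topology

theorem second_deriv_nonpos_of_isLocalMax {f f' : ℝ → ℝ} {D : ℝ}
    (hf : ∀ᶠ t in 𝓝 (0 : ℝ), HasDerivAt f (f' t) t) (hf' : HasDerivAt f' D 0)
    (hmax : IsLocalMax f 0) : D ≤ 0 := by
  by_contra! hD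
  have hd : deriv f =ᶠ[𝓝 0] f' := hf.mono fun t ht => ht.deriv
  have h2 : deriv (deriv f) 0 = D := by rw [hd.deriv_eq, hf'.deriv]
  have hmin : IsLocalMin f 0 := isLocalMin_of_deriv_deriv_pos (by rw [h2]; exact hD)
    hmax.deriv_eq_zero hf.self_of_nhds.continuousAt
  have hc : f =ᶠ[𝓝 0] fun _ => f 0 := by
    filter_upwards [hmin, hmax] with t h h'
    exact le_antisymm h' h
  have : deriv (deriv f) 0 = 0 := by
    rw [hc.deriv.deriv_eq]; simp
  linarith

theorem deriv_nonpos_of_eventually_right_le {f : ℝ → ℝ} {D : ℝ} (hf : HasDerivAt f D 0)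
    (h : ∀ᶠ t in 𝓝[>] (0 : ℝ), f t ≤ f 0) : D ≤ 0 := by
  refine le_of_tendsto hf.tendsto_slope_zero_right ?_
  filter_upwards [h, self_mem_nhdsWithin] with t ht ht0
  have ht0 : 0 < t := ht0
  rw [smul_eq_mul, zero_add]
  exact mul_nonpos_of_nonneg_of_nonpos (inv_nonneg.2 ht0.le) (by linarith)

/-- First derivative along a line of `x ↦ x₀ (f(|x|²) + xₙ² g(|x|²))`. -/
theorem hasDerivAt_barrier_line {f f' g g' : ℝ → ℝ} (hf : ∀ s > 0, HasDerivAt f (f' s) s)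
    (hg : ∀ s > 0, HasDerivAt g (g' s) s) (a d y e s q k t : ℝ)
    (ht : 0 < s + 2 * q * t + k * t ^ 2) :
    HasDerivAt (fun t => (a + d * t) *
        (f (s + 2 * q * t + k * t ^ 2) + (y + e * t) ^ 2 * g (s + 2 * q * t + k * t ^ 2)))
      (d * (f (s + 2 * q * t + k * t ^ 2) + (y + e * t) ^ 2 * g (s + 2 * q * t + k * t ^ 2)) +
        (a + d * t) * (f' (s + 2 * q * t + k * t ^ 2) * (2 * q + 2 * k * t) +
          (2 * e * (y + e * t) * g (s + 2 * q * t + k * t ^ 2) +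
          (y + e * t) ^ 2 * (g' (s + 2 * q * t + k * t ^ 2) * (2 * q + 2 * k * t))))) t := by
  have hs : HasDerivAt (fun t => s + 2 * q * t + k * t ^ 2) (2 * q + 2 * k * t) t := by
    have := (((hasDerivAt_id t).const_mul (2 * q)).const_add s).add
      (((hasDerivAt_id t).pow 2).const_mul k)
    refine this.congr_deriv ?_
    simp; ring
  have ha : HasDerivAt (fun t => a + d * t) d t := by
    simpa using ((hasDerivAt_id t).const_mul d).const_add a
  have hy : HasDerivAt (fun t => (y + e * t) ^ 2) (2 * e * (y + e * t)) t := by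
    refine ((((hasDerivAt_id t).const_mul e).const_add y).pow 2).congr_deriv ?_
    simp; ring
  have hF := (hf _ ht).comp t hs
  have hG := (hg _ ht).comp t hs
  exact ha.mul (hF.add (hy.mul hG))

/-- Second derivative along a line of `x ↦ x₀ (f(|x|²) + xₙ² g(|x|²))`. -/
theorem hasDerivAt_barrier_line_deriv {f f' f'' g g' g'' : ℝ → ℝ}
    (hf : ∀ s > 0, HasDerivAt f (f' s) s) (hf' : ∀ s > 0, HasDerivAt f' (f'' s) s)
    (hg : ∀ s > 0, HasDerivAt g (g' s) s) (hg' : ∀ s > 0, HasDerivAt g' (g'' s) s)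
    (a d y e s q k : ℝ) (hs0 : 0 < s) :
    HasDerivAt (fun t =>
      (d * (f (s + 2 * q * t + k * t ^ 2) + (y + e * t) ^ 2 * g (s + 2 * q * t + k * t ^ 2)) +
        (a + d * t) * (f' (s + 2 * q * t + k * t ^ 2) * (2 * q + 2 * k * t) +
          (2 * e * (y + e * t) * g (s + 2 * q * t + k * t ^ 2) +
          (y + e * t) ^ 2 * (g' (s + 2 * q * t + k * t ^ 2) * (2 * q + 2 * k * t))))))
      (4 * d * q * f' s + a * (4 * q ^ 2 * f'' s + 2 * k * f' s) + 4 * d * e * y * g s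
        + 2 * e ^ 2 * a * g s + 4 * d * q * y ^ 2 * g' s + 8 * e * q * a * y * g' s
        + a * y ^ 2 * (4 * q ^ 2 * g'' s + 2 * k * g' s)) 0 := by
  have hs : HasDerivAt (fun t => s + 2 * q * t + k * t ^ 2) (2 * q) 0 := by
    have := (((hasDerivAt_id (0:ℝ)).const_mul (2 * q)).const_add s).add
      (((hasDerivAt_id (0:ℝ)).pow 2).const_mul k)
    refine this.congr_deriv ?_
    simp
  have h0 : s + 2 * q * 0 + k * 0 ^ 2 = s := by ring
  have ha : HasDerivAt (fun t => a + d * t) d 0 := by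
    simpa using ((hasDerivAt_id (0:ℝ)).const_mul d).const_add a
  have hy1 : HasDerivAt (fun t => 2 * e * (y + e * t)) (2 * e * e) 0 := by
    simpa using ((((hasDerivAt_id (0:ℝ)).const_mul e).const_add y)).const_mul (2 * e)
  have hq : HasDerivAt (fun t => 2 * q + 2 * k * t) (2 * k) 0 := by
    simpa using ((hasDerivAt_id (0:ℝ)).const_mul (2 * k)).const_add (2 * q)
  have hy : HasDerivAt (fun t => (y + e * t) ^ 2) (2 * e * y) 0 := by
    refine ((((hasDerivAt_id (0:ℝ)).const_mul e).const_add y).pow 2).congr_deriv ?_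
    simp; ring
  have hF := (hf _ (h0.symm ▸ hs0)).comp 0 hs
  have hG := (hg _ (h0.symm ▸ hs0)).comp 0 hs
  have hF' := (hf' _ (h0.symm ▸ hs0)).comp 0 hs
  have hG' := (hg' _ (h0.symm ▸ hs0)).comp 0 hs
  have := ((hF.add (hy.mul hG)).const_mul d).add
    (ha.mul ((hF'.mul hq).add ((hy1.mul hG).add (hy.mul (hG'.mul hq)))))
  refine this.congr_deriv ?_
  simp only [Function.comp, h0]
  simp
  ring

theorem norm_add_smul_single_sq {k : ℕ} (x : E k) (i : Fin k) (t : ℝ) :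
    ‖x + t • EuclideanSpace.single i (1 : ℝ)‖ ^ 2 = ‖x‖ ^ 2 + 2 * x i * t + 1 * t ^ 2 := by
  rw [norm_add_sq_real, real_inner_smul_right, EuclideanSpace.inner_single_right, norm_smul,
    PiLp.norm_single]
  simp
  ring

theorem add_smul_single_apply {k : ℕ} (x : E k) (i j : Fin k) (t : ℝ) :
    (x + t • EuclideanSpace.single i (1 : ℝ)) j = x j + (if j = i then 1 else 0) * t := by
  simp [mul_comm]

theorem norm_sub_single_sq {k : ℕ} (x : E k) (i : Fin k) (b : ℝ) :
    ‖x - EuclideanSpace.single i b‖ ^ 2 = ‖x‖ ^ 2 - 2 * (b * x i) + b ^ 2 := by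
  rw [norm_sub_sq_real, EuclideanSpace.inner_single_right, PiLp.norm_single]
  simp

theorem norm_add_smul_sub_single_sq {k : ℕ} (x : E k) (i : Fin k) (b μ t : ℝ) :
    ‖x + t • μ • (x - EuclideanSpace.single i b)‖ ^ 2 =
      ‖x‖ ^ 2 + 2 * (μ * (‖x‖ ^ 2 - b * x i)) * t
        + (μ ^ 2 * (‖x‖ ^ 2 - 2 * (b * x i) + b ^ 2)) * t ^ 2 := by
  rw [norm_add_sq_real, smul_smul, norm_smul, mul_pow, norm_sub_single_sq, real_inner_smul_right,
    inner_sub_right, EuclideanSpace.inner_single_right, real_inner_self_eq_norm_sq,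
    Real.norm_eq_abs, sq_abs]
  simp
  ring

theorem abs_apply_le_norm {k : ℕ} (x : E k) (i : Fin k) : |x i| ≤ ‖x‖ := by
  simpa using PiLp.norm_apply_le x i

/-- With `c² - τ` the squared radius, the points of the ball `‖x‖² ≤ L` that lie outside the two
open balls centered at `±c eₙ`. -/
def shell (m : ℕ) (c τ L : ℝ) : Set (E (m+1)) :=
  {x | ‖x‖ ^ 2 ≤ L ∧ 2 * c * |x (Fin.last m)| ≤ ‖x‖ ^ 2 + τ}

theorem isCompact_shell (m : ℕ) (c τ L : ℝ) : IsCompact (shell m c τ L) := by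
  refine Metric.isCompact_of_isClosed_isBounded ?_ ?_
  · apply IsClosed.and <;> exact isClosed_le (by fun_prop) (by fun_prop)
  · refine (Metric.isBounded_closedBall (x := (0 : E (m+1))) (r := Real.sqrt L)).subset ?_
    intro x hx
    rw [mem_closedBall_zero_iff]
    exact Real.le_sqrt_of_sq_le hx.1

/-- The properties of (multiples of) `u(x) - u(-x₁, x₂, …, xₙ)` that the comparison principle
uses. -/
structure IsOddRobinSolution (m : ℕ) (μ γ c τ L A : ℝ) (w : E (m+1) → ℝ) : Prop where
  continuousOn : ContinuousOn w (shell m c τ L)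
  harmonic : ∀ x : E (m+1), ‖x‖ ^ 2 < L → 2 * c * |x (Fin.last m)| < ‖x‖ ^ 2 + τ →
    ∃ D : Fin (m+1) → ℝ, ∑ i, D i = 0 ∧ ∀ i, ∃ B : ℝ → ℝ,
      (∀ᶠ t in 𝓝 (0 : ℝ),
        HasDerivAt (fun t : ℝ => w (x + t • EuclideanSpace.single i (1 : ℝ))) (B t) t) ∧
      HasDerivAt B (D i) 0
  robin : ∀ (x : E (m+1)) (σ : ℝ), σ ^ 2 = 1 → 2 * c * (σ * x (Fin.last m)) = ‖x‖ ^ 2 + τ →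
    HasDerivAt (fun t : ℝ => w (x + t • μ • (x - EuclideanSpace.single (Fin.last m) (σ * c))))
      (w x / γ) 0
  eq_zero : ∀ x, x 0 = 0 → w x = 0
  eq_outer : ∀ x : E (m+1), ‖x‖ ^ 2 = L → w x = A * x 0

theorem IsOddRobinSolution.const_mul {m : ℕ} {μ γ c τ L A : ℝ} {w : E (m+1) → ℝ}
    (hw : IsOddRobinSolution m μ γ c τ L A w) (M : ℝ) :
    IsOddRobinSolution m μ γ c τ L (M * A) fun x => M * w x where
  continuousOn := hw.continuousOn.const_smul M
  harmonic x h1 h2 := by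
    obtain ⟨D, hD, hB⟩ := hw.harmonic x h1 h2
    refine ⟨fun i => M * D i, by rw [← Finset.mul_sum, hD, mul_zero], fun i => ?_⟩
    obtain ⟨B, hB1, hB2⟩ := hB i
    exact ⟨fun t => M * B t, hB1.mono fun t ht => ht.const_mul M, hB2.const_mul M⟩
  robin x σ h1 h2 := by
    rw [mul_div_assoc]
    exact (hw.robin x σ h1 h2).const_mul M
  eq_zero x h := by rw [hw.eq_zero x h, mul_zero]
  eq_outer x h := by rw [hw.eq_outer x h, mul_assoc]

theorem sum_barrier_second_deriv {m : ℕ} (hm : 1 ≤ m) (x : E (m+1)) (A1 A2 G G1 G2 : ℝ) :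
    ∑ i : Fin (m+1),
      (4 * (if 0 = i then 1 else 0) * x i * A1
        + x 0 * (4 * x i ^ 2 * A2 + 2 * 1 * A1)
        + 4 * (if 0 = i then 1 else 0) * (if Fin.last m = i then 1 else 0) * x (Fin.last m) * G
        + 2 * (if Fin.last m = i then 1 else 0) ^ 2 * x 0 * G
        + 4 * (if 0 = i then 1 else 0) * x i * x (Fin.last m) ^ 2 * G1
        + 8 * (if Fin.last m = i then 1 else 0) * x i * x 0 * x (Fin.last m) * G1
        + x 0 * x (Fin.last m) ^ 2 * (4 * x i ^ 2 * G2 + 2 * 1 * G1)) =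
    x 0 * (4 * ‖x‖ ^ 2 * A2 + (2 * (m + 1) + 4) * A1 + 2 * G
      + x (Fin.last m) ^ 2 * (4 * ‖x‖ ^ 2 * G2 + (2 * (m + 1) + 12) * G1)) := by
  have hne : (0 : Fin (m+1)) ≠ Fin.last m := by
    intro h
    have := congrArg Fin.val h
    simp at this
    omega
  have h1 : ∑ i : Fin (m+1), (if 0 = i then (1 : ℝ) else 0) * x i = x 0 := by simp
  have h2 : ∑ i : Fin (m+1), (if Fin.last m = i then (1 : ℝ) else 0) * x i = x (Fin.last m) := by
    simp
  have h3 : ∑ i : Fin (m+1), (if 0 = i then (1 : ℝ) else 0) * (if Fin.last m = i then 1 else 0)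
      = 0 := by
    refine Finset.sum_eq_zero fun i _ => ?_
    by_cases h : 0 = i
    · simp [← h, hne.symm]
    · simp [h]
  have h4 : ∑ i : Fin (m+1), (if Fin.last m = i then (1 : ℝ) else 0) ^ 2 = 1 := by
    simp
  have h5 : ∑ i : Fin (m+1), x i ^ 2 = ‖x‖ ^ 2 := (EuclideanSpace.real_norm_sq_eq x).symm
  have h6 : ∑ _i : Fin (m+1), (1 : ℝ) = m + 1 := by simp
  trans (4 * A1 + 4 * x (Fin.last m) ^ 2 * G1) *
      ∑ i : Fin (m+1), (if 0 = i then (1 : ℝ) else 0) * x i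
    + (8 * x 0 * x (Fin.last m) * G1) *
      ∑ i : Fin (m+1), (if Fin.last m = i then (1 : ℝ) else 0) * x i
    + (4 * x (Fin.last m) * G) *
      ∑ i : Fin (m+1), (if 0 = i then (1 : ℝ) else 0) * (if Fin.last m = i then 1 else 0)
    + (2 * x 0 * G) * ∑ i : Fin (m+1), (if Fin.last m = i then (1 : ℝ) else 0) ^ 2
    + (4 * x 0 * A2 + 4 * x 0 * x (Fin.last m) ^ 2 * G2) * ∑ i : Fin (m+1), x i ^ 2
    + (2 * x 0 * A1 + 2 * x 0 * x (Fin.last m) ^ 2 * G1) * ∑ _i : Fin (m+1), (1 : ℝ)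
  · simp_rw [Finset.mul_sum, ← Finset.sum_add_distrib]
    exact Finset.sum_congr rfl fun i _ => by ring
  · rw [h1, h2, h3, h4, h5, h6]
    ring

theorem norm_sq_lt_of_mem_sphere {m : ℕ} {μ c τ : ℝ} (hμ : 0 < μ) (hc0 : 0 < c) (hc : c < 3 / μ)
    (hτ : c ^ 2 - τ = 1 / μ ^ 2) {x : E (m+1)} {σ : ℝ} (hσ : σ ^ 2 = 1)
    (hx : 2 * c * (σ * x (Fin.last m)) = ‖x‖ ^ 2 + τ) : ‖x‖ ^ 2 < 25 / μ ^ 2 := by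
  have hσ1 : |σ| = 1 := by
    rcases (show σ = 1 ∨ σ = -1 by simpa using hσ) with rfl | rfl <;> simp
  have h1 : σ * x (Fin.last m) ≤ ‖x‖ := by
    refine (le_abs_self _).trans ?_
    rw [abs_mul, hσ1, one_mul]
    exact abs_apply_le_norm _ _
  have h2 : (‖x‖ - c) ^ 2 ≤ (1 / μ) ^ 2 := by
    have := mul_le_mul_of_nonneg_left h1 hc0.le
    rw [one_div_pow]
    nlinarith
  have h3 := (le_abs_self _).trans (abs_le_of_sq_le_sq h2 (by positivity))
  have h4 : ‖x‖ < 4 / μ := by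
    have : 4 / μ = 3 / μ + 1 / μ := by ring
    linarith
  calc ‖x‖ ^ 2 < (5 / μ) ^ 2 :=
        pow_lt_pow_left₀ (h4.trans (by gcongr; norm_num)) (norm_nonneg _) two_ne_zero
    _ = 25 / μ ^ 2 := by ring

/-- Comparison principle in `{x₁ > 0}` for a strict subsolution `x₁ (f(|x|²) + xₙ² g(|x|²))`. -/
theorem IsOddRobinSolution.barrier_le {m : ℕ} (hm : 1 ≤ m) {μ γ c τ L A ρ : ℝ} (hμ : 0 < μ)
    (hγ : 0 < γ) (hτ : 0 < τ) (hcτ : τ ≤ c ^ 2) (hρ : 0 ≤ ρ)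
    {w : E (m+1) → ℝ} (hw : IsOddRobinSolution m μ γ c τ L A w)
    {f f' f'' g g' g'' : ℝ → ℝ}
    (hf : ∀ s > 0, HasDerivAt f (f' s) s) (hf' : ∀ s > 0, HasDerivAt f' (f'' s) s)
    (hg : ∀ s > 0, HasDerivAt g (g' s) s) (hg' : ∀ s > 0, HasDerivAt g' (g'' s) s)
    (hfc : ContinuousOn f (Ici ρ)) (hgc : ContinuousOn g (Ici ρ))
    (hlap : ∀ s y : ℝ, ρ < s → s < L → 2 * c * |y| < s + τ →
      0 < 4 * s * f'' s + (2 * (m + 1) + 4) * f' s + 2 * g s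
        + y ^ 2 * (4 * s * g'' s + (2 * (m + 1) + 12) * g' s))
    (hrob : ∀ s y : ℝ, ρ < s → s < L → 2 * c * y = s + τ →
      f s + y ^ 2 * g s + γ * μ * (-f s + (τ - s) * f' s + (s + τ) * g s - 3 * y ^ 2 * g s
        + y ^ 2 * (τ - s) * g' s) ≤ 0)
    (hin : ∀ x : E (m+1), x ∈ shell m c τ L → 0 < x 0 → ‖x‖ ^ 2 = ρ →
      x 0 * (f (‖x‖ ^ 2) + x (Fin.last m) ^ 2 * g (‖x‖ ^ 2)) ≤ w x)
    (hout : ∀ y : ℝ, y ^ 2 ≤ L → f L + y ^ 2 * g L ≤ A)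
    {x : E (m+1)} (hx : x ∈ shell m c τ L) (hx0 : 0 ≤ x 0) (hxρ : ρ ≤ ‖x‖ ^ 2) :
    x 0 * (f (‖x‖ ^ 2) + x (Fin.last m) ^ 2 * g (‖x‖ ^ 2)) ≤ w x := by
  set v : E (m+1) → ℝ := fun x => x 0 * (f (‖x‖ ^ 2) + x (Fin.last m) ^ 2 * g (‖x‖ ^ 2)) with hv
  set K : Set (E (m+1)) := shell m c τ L ∩ {x | 0 ≤ x 0 ∧ ρ ≤ ‖x‖ ^ 2} with hK
  have hKc : IsCompact K := by
    refine (isCompact_shell m c τ L).inter_right ?_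
    apply IsClosed.and <;> exact isClosed_le (by fun_prop) (by fun_prop)
  have hnc : Continuous fun x : E (m+1) => ‖x‖ ^ 2 := by fun_prop
  have hvc : ContinuousOn v K := by
    have h1 : ContinuousOn (fun x : E (m+1) => f (‖x‖ ^ 2)) K :=
      hfc.comp hnc.continuousOn fun x hx => hx.2.2
    have h2 : ContinuousOn (fun x : E (m+1) => g (‖x‖ ^ 2)) K :=
      hgc.comp hnc.continuousOn fun x hx => hx.2.2
    have h3 : Continuous fun x : E (m+1) => x 0 := by fun_prop
    have h4 : Continuous fun x : E (m+1) => x (Fin.last m) ^ 2 := by fun_prop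
    exact h3.continuousOn.mul (h1.add (h4.continuousOn.mul h2))
  obtain ⟨p, hp, hpmax⟩ := hKc.exists_isMaxOn ⟨x, hx, hx0, hxρ⟩
    (hvc.sub (hw.continuousOn.mono inter_subset_left))
  have hpmax : ∀ z ∈ K, v z - w z ≤ v p - w p := fun z hz => hpmax hz
  suffices h : v p - w p ≤ 0 by
    have := hpmax x ⟨hx, hx0, hxρ⟩
    show v x ≤ w x
    linarith
  by_contra! hpos
  have hp0 : 0 < p 0 := by
    refine lt_of_le_of_ne hp.2.1 fun h => ?_
    rw [hw.eq_zero p h.symm] at hpos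
    simp [hv, ← h] at hpos
  have hpρ : ρ < ‖p‖ ^ 2 := by
    refine lt_of_le_of_ne hp.2.2 fun h => ?_
    have := hin p hp.1 hp0 h.symm
    simp only [hv] at hpos
    linarith
  have hpL : ‖p‖ ^ 2 < L := by
    refine lt_of_le_of_ne hp.1.1 fun h => ?_
    rw [hw.eq_outer p h] at hpos
    have h1 := hout (p (Fin.last m)) (by
      rw [← h, ← sq_abs]; exact pow_le_pow_left₀ (abs_nonneg _) (abs_apply_le_norm _ _) 2)
    simp only [hv, h] at hpos
    nlinarith
  have hs0 : 0 < ‖p‖ ^ 2 := hρ.trans_lt hpρ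
  rcases hp.1.2.lt_or_eq with hint | hbd
  · obtain ⟨D, hD, hB⟩ := hw.harmonic p hpL hint
    have key : ∀ i : Fin (m+1), (4 * (if 0 = i then 1 else 0) * p i * f' (‖p‖ ^ 2)
        + p 0 * (4 * p i ^ 2 * f'' (‖p‖ ^ 2) + 2 * 1 * f' (‖p‖ ^ 2))
        + 4 * (if 0 = i then 1 else 0) * (if Fin.last m = i then 1 else 0)
          * p (Fin.last m) * g (‖p‖ ^ 2)
        + 2 * (if Fin.last m = i then 1 else 0) ^ 2 * p 0 * g (‖p‖ ^ 2)
        + 4 * (if 0 = i then 1 else 0) * p i * p (Fin.last m) ^ 2 * g' (‖p‖ ^ 2)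
        + 8 * (if Fin.last m = i then 1 else 0) * p i * p 0 * p (Fin.last m) * g' (‖p‖ ^ 2)
        + p 0 * p (Fin.last m) ^ 2 * (4 * p i ^ 2 * g'' (‖p‖ ^ 2) + 2 * 1 * g' (‖p‖ ^ 2)))
        ≤ D i := by
      intro i
      obtain ⟨B, hB1, hB2⟩ := hB i
      have hline : Continuous fun t : ℝ => p + t • EuclideanSpace.single i (1 : ℝ) := by fun_prop
      have hev : ∀ᶠ t in 𝓝 (0 : ℝ), p + t • EuclideanSpace.single i (1 : ℝ) ∈ K := by
        have hU : IsOpen {z : E (m+1) | (‖z‖ ^ 2 < L ∧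
            2 * c * |z (Fin.last m)| < ‖z‖ ^ 2 + τ) ∧ 0 < z 0 ∧ ρ < ‖z‖ ^ 2} := by
          apply IsOpen.and <;> apply IsOpen.and <;> exact isOpen_lt (by fun_prop) (by fun_prop)
        have := hline.continuousAt.preimage_mem_nhds (x := (0 : ℝ))
          (hU.mem_nhds (by simpa using ⟨⟨hpL, hint⟩, hp0, hpρ⟩))
        filter_upwards [this] with t ht
        exact ⟨⟨ht.1.1.le, ht.1.2.le⟩, ht.2.1.le, ht.2.2.le⟩
      have hvl : ∀ t : ℝ, v (p + t • EuclideanSpace.single i (1 : ℝ)) =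
          (p 0 + (if 0 = i then 1 else 0) * t) *
          (f (‖p‖ ^ 2 + 2 * p i * t + 1 * t ^ 2) + (p (Fin.last m) +
            (if Fin.last m = i then 1 else 0) * t) ^ 2 *
              g (‖p‖ ^ 2 + 2 * p i * t + 1 * t ^ 2)) := by
        intro t
        simp only [hv, norm_add_smul_single_sq, add_smul_single_apply]
      have hpos' : ∀ᶠ t in 𝓝 (0 : ℝ), 0 < ‖p‖ ^ 2 + 2 * p i * t + 1 * t ^ 2 := by
        have : Continuous fun t : ℝ => ‖p‖ ^ 2 + 2 * p i * t + 1 * t ^ 2 := by fun_prop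
        exact this.continuousAt.eventually (lt_mem_nhds (by simpa using hs0))
      have hA2 := hasDerivAt_barrier_line_deriv hf hf' hg hg' (p 0) (if 0 = i then 1 else 0)
        (p (Fin.last m)) (if Fin.last m = i then 1 else 0) _ (p i) 1 hs0
      have := second_deriv_nonpos_of_isLocalMax
        (f := fun t => v (p + t • EuclideanSpace.single i (1 : ℝ)) -
          w (p + t • EuclideanSpace.single i (1 : ℝ)))
        (by
          filter_upwards [hpos', hB1] with t ht hBt
          refine HasDerivAt.sub ?_ hBt
          rw [funext hvl]
          exact hasDerivAt_barrier_line hf hg (p 0) (if 0 = i then 1 else 0)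
            (p (Fin.last m)) (if Fin.last m = i then 1 else 0) _ (p i) 1 t ht)
        (hA2.sub hB2)
        (by
          filter_upwards [hev] with t ht
          simpa using hpmax _ ht)
      linarith
    have hsum := Finset.sum_le_sum fun i (_ : i ∈ Finset.univ) => key i
    rw [sum_barrier_second_deriv hm p, hD] at hsum
    have := mul_pos hp0 (hlap _ _ hpρ hpL hint)
    linarith
  · obtain ⟨σ, hσ, hσy⟩ : ∃ σ : ℝ, σ ^ 2 = 1 ∧ |p (Fin.last m)| = σ * p (Fin.last m) := by
      rcases abs_choice (p (Fin.last m)) with h | h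
      · exact ⟨1, by norm_num, by rw [one_mul, h]⟩
      · exact ⟨-1, by norm_num, by rw [h]; ring⟩
    rw [hσy] at hbd
    set y := p (Fin.last m) with hy
    set b : E (m+1) := EuclideanSpace.single (Fin.last m) (σ * c) with hb
    have h0last : (0 : Fin (m+1)) ≠ Fin.last m := by
      intro h
      have := congrArg Fin.val h
      simp at this
      omega
    have hrw := hw.robin p σ hσ hbd
    have hv0 : ∀ t : ℝ, (p + t • μ • (p - b)) 0 = p 0 + (μ * p 0) * t := by
      intro t
      simp [hb, h0last]
      ring
    have hvy : ∀ t : ℝ, (p + t • μ • (p - b)) (Fin.last m) = y + (μ * (y - σ * c)) * t := by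
      intro t
      simp [hb, hy]
      ring
    have hvn := norm_add_smul_sub_single_sq p (Fin.last m) (σ * c) μ
    have hvl : ∀ t : ℝ, v (p + t • μ • (p - b)) =
        (p 0 + (μ * p 0) * t) *
          (f (‖p‖ ^ 2 + 2 * (μ * (‖p‖ ^ 2 - σ * c * y)) * t
              + (μ ^ 2 * (‖p‖ ^ 2 - 2 * (σ * c * y) + (σ * c) ^ 2)) * t ^ 2) +
            (y + (μ * (y - σ * c)) * t) ^ 2 * g (‖p‖ ^ 2 + 2 * (μ * (‖p‖ ^ 2 - σ * c * y)) * t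
              + (μ ^ 2 * (‖p‖ ^ 2 - 2 * (σ * c * y) + (σ * c) ^ 2)) * t ^ 2)) := by
      intro t
      simp only [hv]
      rw [hvn, hv0, hvy]
    have hA := hasDerivAt_barrier_line hf hg (p 0) (μ * p 0) y (μ * (y - σ * c)) (‖p‖ ^ 2)
      (μ * (‖p‖ ^ 2 - σ * c * y)) (μ ^ 2 * (‖p‖ ^ 2 - 2 * (σ * c * y) + (σ * c) ^ 2)) 0
      (by simpa using hs0)
    rw [← funext hvl] at hA
    have hline : Continuous fun t : ℝ => p + t • μ • (p - b) := by fun_prop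
    have hev : ∀ᶠ t in 𝓝[>] (0 : ℝ), p + t • μ • (p - b) ∈ K := by
      have hU : IsOpen {z : E (m+1) | (‖z‖ ^ 2 < L ∧
          2 * c * (-σ * z (Fin.last m)) < ‖z‖ ^ 2 + τ) ∧ 0 < z 0 ∧ ρ < ‖z‖ ^ 2} := by
        apply IsOpen.and <;> apply IsOpen.and <;> exact isOpen_lt (by fun_prop) (by fun_prop)
      have := hline.continuousAt.preimage_mem_nhds (x := (0 : ℝ))
        (hU.mem_nhds (by
          simp only [zero_smul, add_zero]
          exact ⟨⟨hpL, by nlinarith⟩, hp0, hpρ⟩))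
      filter_upwards [nhdsWithin_le_nhds this, self_mem_nhdsWithin] with t ht ht0
      have ht0 : 0 < t := ht0
      refine ⟨⟨ht.1.1.le, ?_⟩, ht.2.1.le, ht.2.2.le⟩
      have h1 := ht.1.2
      have h2 : 2 * c * (σ * (p + t • μ • (p - b)) (Fin.last m)) ≤
          ‖p + t • μ • (p - b)‖ ^ 2 + τ := by
        rw [hvn, hvy]
        have : 0 ≤ (c ^ 2 - τ) * (2 * (μ * t) + (μ * t) ^ 2) :=
          mul_nonneg (by linarith) (by positivity)
        rw [← hy]
        linear_combination this + (1 + 2 * (μ * t) + (μ * t) ^ 2) * hbd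
          - c ^ 2 * (2 * (μ * t) + (μ * t) ^ 2) * hσ
      beta_reduce at h1
      generalize (p + t • μ • (p - b)) = z at h1 h2 ⊢
      have h3 : |z (Fin.last m)| = σ * z (Fin.last m) ∨ |z (Fin.last m)| = -σ * z (Fin.last m) := by
        rcases (show σ = 1 ∨ σ = -1 by simpa using hσ) with rfl | rfl
        · rw [neg_mul, one_mul]; exact abs_choice _
        · rw [neg_neg, neg_mul, one_mul]; exact (abs_choice _).symm
      rcases h3 with h3 | h3 <;> rw [h3]
      · exact h2
      · exact h1.le
    have hD := deriv_nonpos_of_eventually_right_le (hA.sub hrw) (by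
      filter_upwards [hev] with t ht
      simpa using hpmax _ ht)
    have hr := hrob (‖p‖ ^ 2) (σ * y) hpρ hpL hbd
    set s := ‖p‖ ^ 2 with hs
    simp only [mul_zero, add_zero, ne_eq, OfNat.ofNat_ne_zero, not_false_eq_true, zero_pow] at hD
    have hσy2 : (σ * y) ^ 2 = y ^ 2 := by rw [mul_pow, hσ, one_mul]
    rw [hσy2] at hr
    have hvp : v p = p 0 * (f s + y ^ 2 * g s) := rfl
    rw [sub_nonpos, le_div_iff₀ hγ] at hD
    have hr' := mul_nonpos_of_nonneg_of_nonpos hp0.le hr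
    have : v p - w p ≤ 0 := by
      rw [hvp]
      linear_combination hr' + hD + γ * p 0 * μ * (f' s + y ^ 2 * g' s + g s) * hbd
    linarith

theorem IsOddRobinSolution.apply_zero_le {m : ℕ} (hm : 1 ≤ m) {μ γ c τ : ℝ} (hμ : 0 < μ)
    (hγ : 0 < γ) (hΓ : 1 < γ * μ) (hτ : 0 < τ) (hτμ : τ ≤ 1 / μ ^ 2) (hcτ : τ ≤ c ^ 2)
    {w : E (m+1) → ℝ} (hw : IsOddRobinSolution m μ γ c τ (25 / μ ^ 2) 2 w)
    {x : E (m+1)} (hx : x ∈ shell m c τ (25 / μ ^ 2)) (hx0 : 0 ≤ x 0) : x 0 ≤ w x := by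
  set θ : ℝ := (γ * μ - 1) * μ ^ 2 / (25 * (γ * μ)) with hθ
  have hθ0 : 0 < θ := by
    have : 0 < γ * μ - 1 := by linarith
    positivity
  have hθ1 : γ * μ * θ = (γ * μ - 1) * μ ^ 2 / 25 := by
    rw [hθ]; field_simp
  have hθL : θ * (25 / μ ^ 2) = (γ * μ - 1) / (γ * μ) := by
    rw [hθ]; field_simp
  have hτ' : μ ^ 2 * τ ≤ 1 := by
    rw [le_div_iff₀ (by positivity)] at hτμ
    linarith
  have h := hw.barrier_le hm hμ hγ hτ hcτ le_rfl (f := fun s => 1 + θ * s) (f' := fun _ => θ)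
    (f'' := fun _ => 0) (g := fun _ => 0) (g' := fun _ => 0) (g'' := fun _ => 0)
    (fun s _ => by simpa using ((hasDerivAt_id s).const_mul θ).const_add 1)
    (fun s _ => hasDerivAt_const _ _) (fun s _ => hasDerivAt_const _ _)
    (fun s _ => hasDerivAt_const _ _) (by fun_prop) (by fun_prop)
    (fun s y _ _ _ => by
      simp only [mul_zero, zero_add, add_zero]
      positivity)
    (fun s y hs _ _ => by
      have h1 : γ * μ * θ * τ ≤ γ * μ - 1 := by
        rw [hθ1]
        nlinarith
      have h2 : 0 ≤ γ * μ * θ * s := by positivity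
      have h3 : 0 ≤ (γ * μ - 1) * (θ * s) := mul_nonneg (by linarith) (by positivity)
      simp only [mul_zero, add_zero, sub_zero]
      nlinarith)
    (fun z _ hz0 hz => by
      have : z = 0 := by simpa using hz
      simp [this] at hz0)
    (fun y _ => by
      simp only [mul_zero, add_zero]
      rw [hθL]
      have : (γ * μ - 1) / (γ * μ) ≤ 1 := by
        rw [div_le_one (by positivity)]; linarith
      linarith) hx hx0 (by positivity)
  refine le_trans ?_ h
  simp only [mul_zero, add_zero]
  have : 0 ≤ x 0 * (θ * ‖x‖ ^ 2) := by positivity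
  linarith

/-- Left side of the Laplace condition for the power barrier, with `P = s ^ p`, `r = √s`. -/
theorem power_barrier_laplace_pos {n p κ a b μ H s y P r : ℝ} (hn : 2 ≤ n) (hp : -1 / 2 < p)
    (hp0 : p < 0) (hκ : κ = -p * (2 * p + n)) (ha : 0 ≤ a)
    (hb : κ * (1 - p) * (4 * p + 2 * n + 4) * μ ^ 2 * H < b * (n + 1)) (hs : 0 < s)
    (hr : 0 < r) (hP : 0 < P) (hPs : P * s ≤ H * r) (hy : y ^ 2 ≤ μ ^ 2 * s ^ 2) :
    0 < 4 * s * (p * (p - 1) * (P / s ^ 2) - a * ((1 / 2 - 1) * (1 / 2 - 2) * (r / s ^ 3)) +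
          b * (1 / 2 * (1 / 2 - 1) * (r / s ^ 2)))
      + (2 * n + 4) * (p * (P / s ^ 1) - a * ((1 / 2 - 1) * (r / s ^ 2)) + b * (1 / 2 * (r / s ^ 1)))
      + 2 * (κ * (P / s ^ 1) - a * ((n - 1) / 2) * (r / s ^ 2))
      + y ^ 2 * (4 * s * (κ * ((p - 1) * (p - 2) * (P / s ^ 3))
            - a * ((n - 1) / 2) * ((1 / 2 - 2) * (1 / 2 - 3) * (r / s ^ 4)))
        + (2 * n + 12) * (κ * ((p - 1) * (P / s ^ 2))
            - a * ((n - 1) / 2) * ((1 / 2 - 2) * (r / s ^ 3)))) := by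
  have hκ0 : 0 < κ := by rw [hκ]; exact mul_pos (by linarith) (by linarith)
  have h1 : κ * (1 - p) * (4 * p + 2 * n + 4) * (y ^ 2 * P) ≤
      κ * (1 - p) * (4 * p + 2 * n + 4) * (μ ^ 2 * s * (H * r)) := by
    refine mul_le_mul_of_nonneg_left ?_
      (mul_nonneg (mul_nonneg hκ0.le (by linarith)) (by linarith))
    calc y ^ 2 * P ≤ μ ^ 2 * s ^ 2 * P := by gcongr
      _ = μ ^ 2 * s * (P * s) := by ring
      _ ≤ μ ^ 2 * s * (H * r) := by gcongr
  have h2 : 0 < (b * (n + 1) - κ * (1 - p) * (4 * p + 2 * n + 4) * μ ^ 2 * H) * (r * s) :=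
    mul_pos (by linarith) (by positivity)
  have h3 : 0 ≤ 3 * (n + 1) * a * ((n - 1) / 2) * r * y ^ 2 / s ^ 3 := by
    have : 0 ≤ (n - 1) / 2 := by linarith
    have : 0 ≤ n + 1 := by linarith
    positivity
  have h4 : 0 < (b * (n + 1) * (r * s) - κ * (1 - p) * (4 * p + 2 * n + 4) * (y ^ 2 * P)) / s ^ 2 :=
    div_pos (by linarith) (by positivity)
  have h5 := add_pos_of_pos_of_nonneg h4 h3
  refine h5.trans_eq ?_
  rw [hκ]
  field_simp
  ring

/-- The Robin condition for the power barrier, with `P = s ^ p`, `r = √s`. -/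
theorem power_barrier_robin_nonpos {n p κ a b μ Γ τ s y P r : ℝ} (hn : 2 ≤ n) (hp : -1 / 2 < p)
    (hp0 : p < 0) (hκ : κ = -p * (2 * p + n)) (hΓ : 1 < Γ)
    (hpΓ : Γ * (1 + (n + 1) * p + 2 * p ^ 2) = 1) (ha : 0 ≤ a)
    (hb : 3 * a * Γ * ((n - 1) / 2) * μ ^ 2 ≤ b * (Γ - 1)) (hb0 : 0 ≤ b) (hs : 0 < s)
    (hτ : 0 < τ) (hτs : τ < s)
    (hr : 0 < r) (hP : 0 < P) (hPτ : Γ * (p + κ) * (P * τ) ≤ a * r) (hy : y ^ 2 ≤ μ ^ 2 * s ^ 2) :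
    (P - a * (r / s ^ 1) + b * r) + y ^ 2 * (κ * (P / s ^ 1) - a * ((n - 1) / 2) * (r / s ^ 2))
      + Γ * (-(P - a * (r / s ^ 1) + b * r)
        + (τ - s) * (p * (P / s ^ 1) - a * ((1 / 2 - 1) * (r / s ^ 2)) + b * (1 / 2 * (r / s ^ 1)))
        + (s + τ) * (κ * (P / s ^ 1) - a * ((n - 1) / 2) * (r / s ^ 2))
        - 3 * y ^ 2 * (κ * (P / s ^ 1) - a * ((n - 1) / 2) * (r / s ^ 2))
        + y ^ 2 * (τ - s) * (κ * ((p - 1) * (P / s ^ 2))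
            - a * ((n - 1) / 2) * ((1 / 2 - 2) * (r / s ^ 3)))) ≤ 0 := by
  have hκ0 : 0 < κ := by rw [hκ]; exact mul_pos (by linarith) (by linarith)
  obtain ⟨T, rfl⟩ : ∃ T, τ = T * s := ⟨τ / s, by field_simp⟩
  obtain ⟨Y, hY⟩ : ∃ Y, y ^ 2 = Y * s := ⟨y ^ 2 / s, by field_simp⟩
  have hT0 : 0 < T := pos_of_mul_pos_left hτ hs.le
  have hT1 : T < 1 := by nlinarith
  have hY0 : 0 ≤ Y := by
    have : 0 ≤ Y * s := hY ▸ sq_nonneg y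
    exact nonneg_of_mul_nonneg_left this hs
  have hY1 : Y ≤ μ ^ 2 * s := by
    rw [hY] at hy
    nlinarith
  rw [hY]
  have hn1 : 0 ≤ (n - 1) / 2 := by linarith
  have e1 : P * ((1 - Γ * (1 + p - κ)) + Γ * T * (p + κ) +
      κ * Y * (1 - 3 * Γ + Γ * (1 - p) * (1 - T))) ≤ P * (Γ * T * (p + κ)) := by
    refine mul_le_mul_of_nonneg_left ?_ hP.le
    have h1 : 1 - Γ * (1 + p - κ) = 0 := by rw [hκ]; linear_combination -hpΓ
    have h2 : Γ * (1 - p) * (1 - T) ≤ Γ * (3 / 2) := by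
      rw [mul_assoc]
      refine mul_le_mul_of_nonneg_left ?_ (by linarith)
      nlinarith
    have h3 : κ * Y * (1 - 3 * Γ + Γ * (1 - p) * (1 - T)) ≤ 0 :=
      mul_nonpos_of_nonneg_of_nonpos (by positivity) (by linarith)
    linarith
  have e2 : 1 - 3 * Γ * ((n - 1) / 2) * (μ ^ 2 * s) ≤
      (1 + Γ * (n - 2) / 2) + Γ * T * ((n - 2) / 2) +
        ((n - 1) / 2) * Y * (1 - 3 * Γ + Γ * (3 / 2) * (1 - T)) := by
    have h1 : 0 ≤ Γ * (n - 2) / 2 := by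
      have : 0 ≤ n - 2 := by linarith
      positivity
    have h2 : 0 ≤ Γ * T * ((n - 2) / 2) := by
      have : 0 ≤ n - 2 := by linarith
      positivity
    have h3 : 0 ≤ ((n - 1) / 2) * Y * (1 + Γ * (3 / 2) * (1 - T)) := by
      have : 0 ≤ 1 - T := by linarith
      positivity
    have h4 : ((n - 1) / 2) * (3 * Γ) * Y ≤ ((n - 1) / 2) * (3 * Γ) * (μ ^ 2 * s) := by gcongr
    linarith
  have e3 : b * r * (1 - Γ + Γ / 2 * (T - 1)) ≤ b * r * (1 - Γ) := by
    refine mul_le_mul_of_nonneg_left ?_ (by positivity)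
    nlinarith
  have e4 := mul_le_mul_of_nonneg_left e2 (show 0 ≤ a * (r / s) by positivity)
  have e5 : P * (Γ * T * (p + κ)) ≤ a * (r / s) := by
    rw [mul_div_assoc', le_div_iff₀ hs]
    linarith
  have e6 : a * (r / s) * (3 * Γ * ((n - 1) / 2) * (μ ^ 2 * s)) ≤ b * r * (Γ - 1) := by
    have := mul_le_mul_of_nonneg_right hb hr.le
    calc _ = 3 * a * Γ * ((n - 1) / 2) * μ ^ 2 * r := by field_simp
      _ ≤ _ := by linarith
  have e7 : P * ((1 - Γ * (1 + p - κ)) + Γ * T * (p + κ) +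
      κ * Y * (1 - 3 * Γ + Γ * (1 - p) * (1 - T)))
      - a * (r / s) * ((1 + Γ * (n - 2) / 2) + Γ * T * ((n - 2) / 2) +
        ((n - 1) / 2) * Y * (1 - 3 * Γ + Γ * (3 / 2) * (1 - T)))
      + b * r * (1 - Γ + Γ / 2 * (T - 1)) ≤ 0 := by linarith
  refine le_of_eq_of_le ?_ e7
  field_simp
  ring

theorem hasDerivAt_rpow_sub (q k : ℝ) {s : ℝ} (hs : 0 < s) :
    HasDerivAt (fun s : ℝ => s ^ (q - k)) ((q - k) * s ^ (q - (k + 1))) s := by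
  have := Real.hasDerivAt_rpow_const (x := s) (p := q - k) (Or.inl hs.ne')
  rwa [sub_sub] at this

/-- The lower bound furnished by the power barrier, on the hyperplane `xₙ = 0`. -/
theorem exists_power_lower_bound {m : ℕ} (hm : 1 ≤ m) {μ γ p : ℝ} (hμ : 0 < μ)
    (hΓ : 1 < γ * μ) (hp : -1 / 2 < p) (hp0 : p < 0)
    (hpΓ : γ * μ * (1 + ((m : ℝ) + 1 + 1) * p + 2 * p ^ 2) = 1) :
    ∃ M K : ℝ, 0 < M ∧ 0 < K ∧ ∀ c τ : ℝ, 1 / μ ≤ c → 0 < τ → τ ≤ 1 / μ ^ 2 →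
      ∀ w : E (m+1) → ℝ, IsOddRobinSolution m μ γ c τ (25 / μ ^ 2) 2 w →
      ∀ x ∈ shell m c τ (25 / μ ^ 2), 0 ≤ x 0 → x (Fin.last m) = 0 → τ ≤ ‖x‖ ^ 2 →
        x 0 * ((‖x‖ ^ 2) ^ p - K * τ ^ (p + 1 / 2) * (‖x‖ ^ 2) ^ (1 / 2 - 1 : ℝ)) ≤ M * w x := by
  have hm' : (1 : ℝ) ≤ m := by exact_mod_cast hm
  have hγ : 0 < γ := pos_of_mul_pos_left (zero_lt_one.trans hΓ) hμ.le
  set n : ℝ := (m : ℝ) + 1 with hn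
  have hn2 : 2 ≤ n := by linarith
  obtain ⟨κ, hκ⟩ : ∃ κ, κ = -p * (2 * p + n) := ⟨_, rfl⟩
  have hκ0 : 0 < κ := by rw [hκ]; exact mul_pos (by linarith) (by linarith)
  have hpκ : 0 ≤ p + κ := by
    have : p + κ = -p * (2 * p + n - 1) := by rw [hκ]; ring
    rw [this]
    exact mul_nonneg (by linarith) (by linarith)
  set L : ℝ := 25 / μ ^ 2 with hL
  have hL0 : 0 < L := by positivity
  set H : ℝ := L ^ (p + 1 / 2) with hH
  have hH0 : 0 < H := by positivity
  set K : ℝ := 1 + κ + γ * μ * (p + κ) with hK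
  have hK0 : 0 < K := by positivity
  have hΓ1 : 0 < γ * μ - 1 := by linarith
  have hn1 : 0 ≤ (n - 1) / 2 := by linarith
  have hq0 : 0 < κ * (1 - p) * (4 * p + 2 * n + 4) * μ ^ 2 * H := by
    have : 0 < 1 - p := by linarith
    have : 0 < 4 * p + 2 * n + 4 := by linarith
    positivity
  set b : ℝ := κ * (1 - p) * (4 * p + 2 * n + 4) * μ ^ 2 * H
    + 3 * (K * H) * (γ * μ) * ((n - 1) / 2) * μ ^ 2 / (γ * μ - 1) with hb
  have hb0 : 0 < b := by positivity
  have hb1 : κ * (1 - p) * (4 * p + 2 * n + 4) * μ ^ 2 * H < b * (n + 1) := by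
    have : 0 ≤ 3 * (K * H) * (γ * μ) * ((n - 1) / 2) * μ ^ 2 / (γ * μ - 1) := by positivity
    nlinarith
  have hb2 : 3 * (K * H) * (γ * μ) * ((n - 1) / 2) * μ ^ 2 ≤ b * (γ * μ - 1) := by
    rw [hb, add_mul _ _ (γ * μ - 1), div_mul_cancel₀ _ hΓ1.ne']
    have := mul_pos hq0 hΓ1
    linarith
  set M : ℝ := L ^ p * (1 + κ) + b * L ^ (1 / 2 : ℝ) with hM
  have hM0 : 0 < M := by positivity
  refine ⟨M, K, hM0, hK0, fun c τ hc hτ hτμ w hw x hx hx0 hy0 hxτ => ?_⟩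
  have hc0 : 0 < c := lt_of_lt_of_le (by positivity) hc
  have hτL : τ ≤ L := hτμ.trans (by rw [hL]; gcongr; norm_num)
  have hcτ : τ ≤ c ^ 2 := hτμ.trans (by
    rw [← one_div_pow]; exact pow_le_pow_left₀ (by positivity) hc 2)
  set a : ℝ := K * τ ^ (p + 1 / 2) with ha
  have ha0 : 0 < a := by positivity
  have haH : a ≤ K * H := by
    rw [ha, hH]
    gcongr
    linarith
  have hR : ∀ s : ℝ, 0 < s → ∀ (q : ℝ) (k : ℕ), s ^ (q - (k : ℝ)) = s ^ q / s ^ k :=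
    fun s hs q k => Real.rpow_sub_natCast hs.ne' q k
  have hR1 : ∀ s : ℝ, 0 < s → ∀ q : ℝ, s ^ (q - 1) = s ^ q / s ^ 1 := fun s hs q => by
    simpa using hR s hs q 1
  have hR2 : ∀ s : ℝ, 0 < s → ∀ q : ℝ, s ^ (q - 2) = s ^ q / s ^ 2 := fun s hs q => by
    exact_mod_cast hR s hs q 2
  have hR3 : ∀ s : ℝ, 0 < s → ∀ q : ℝ, s ^ (q - 3) = s ^ q / s ^ 3 := fun s hs q => by
    exact_mod_cast hR s hs q 3
  have hR4 : ∀ s : ℝ, 0 < s → ∀ q : ℝ, s ^ (q - 4) = s ^ q / s ^ 4 := fun s hs q => by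
    exact_mod_cast hR s hs q 4
  have hd0 : ∀ (q s : ℝ), 0 < s → HasDerivAt (fun s : ℝ => s ^ q) (q * s ^ (q - 1)) s :=
    fun q s hs => Real.hasDerivAt_rpow_const (Or.inl hs.ne')
  have hd1 : ∀ (q s : ℝ), 0 < s →
      HasDerivAt (fun s : ℝ => s ^ (q - 1)) ((q - 1) * s ^ (q - 2)) s := fun q s hs => by
    have := hasDerivAt_rpow_sub q 1 hs
    norm_num at this ⊢; exact this
  have hd2 : ∀ (q s : ℝ), 0 < s →
      HasDerivAt (fun s : ℝ => s ^ (q - 2)) ((q - 2) * s ^ (q - 3)) s := fun q s hs => by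
    have := hasDerivAt_rpow_sub q 2 hs
    norm_num at this ⊢; exact this
  have hd3 : ∀ (q s : ℝ), 0 < s →
      HasDerivAt (fun s : ℝ => s ^ (q - 3)) ((q - 3) * s ^ (q - 4)) s := fun q s hs => by
    have := hasDerivAt_rpow_sub q 3 hs
    norm_num at this ⊢; exact this
  have hy_le : ∀ s y : ℝ, τ < s → 2 * c * |y| ≤ s + τ → y ^ 2 ≤ μ ^ 2 * s ^ 2 := by
    intro s y hs hy
    have h1 : 1 ≤ μ * c := by rwa [div_le_iff₀' hμ] at hc
    have h2 : c * |y| ≤ s := by linarith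
    have h3 : |y| ≤ μ * s := by
      calc |y| = 1 * |y| := (one_mul _).symm
        _ ≤ μ * c * |y| := by gcongr
        _ = μ * (c * |y|) := by ring
        _ ≤ μ * s := by gcongr
    rw [← sq_abs, ← mul_pow]
    exact pow_le_pow_left₀ (abs_nonneg _) h3 2
  have key := (hw.const_mul M).barrier_le hm hμ hγ hτ hcτ hτ.le
    (f := fun s => s ^ p - a * s ^ (1 / 2 - 1 : ℝ) + b * s ^ (1 / 2 : ℝ))
    (f' := fun s => p * s ^ (p - 1) - a * ((1 / 2 - 1) * s ^ (1 / 2 - 2 : ℝ))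
      + b * (1 / 2 * s ^ (1 / 2 - 1 : ℝ)))
    (f'' := fun s => p * (p - 1) * s ^ (p - 2)
      - a * ((1 / 2 - 1) * (1 / 2 - 2) * s ^ (1 / 2 - 3 : ℝ))
      + b * (1 / 2 * (1 / 2 - 1) * s ^ (1 / 2 - 2 : ℝ)))
    (g := fun s => κ * s ^ (p - 1) - a * ((n - 1) / 2) * s ^ (1 / 2 - 2 : ℝ))
    (g' := fun s => κ * ((p - 1) * s ^ (p - 2))
      - a * ((n - 1) / 2) * ((1 / 2 - 2) * s ^ (1 / 2 - 3 : ℝ)))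
    (g'' := fun s => κ * ((p - 1) * (p - 2) * s ^ (p - 3))
      - a * ((n - 1) / 2) * ((1 / 2 - 2) * (1 / 2 - 3) * s ^ (1 / 2 - 4 : ℝ)))
    (fun s hs => ((hd0 p s hs).sub ((hd1 (1 / 2) s hs).const_mul a)).add
      ((hd0 (1 / 2) s hs).const_mul b))
    (fun s hs => by
      have := (((hd1 p s hs).const_mul p).sub
        (((hd2 (1 / 2) s hs).const_mul (1 / 2 - 1)).const_mul a)).add
        (((hd1 (1 / 2) s hs).const_mul (1 / 2)).const_mul b)
      exact this.congr_deriv (by ring))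
    (fun s hs => ((hd1 p s hs).const_mul κ).sub ((hd2 (1 / 2) s hs).const_mul _))
    (fun s hs => by
      have := (((hd2 p s hs).const_mul (p - 1)).const_mul κ).sub
        (((hd3 (1 / 2) s hs).const_mul (1 / 2 - 2)).const_mul (a * ((n - 1) / 2)))
      exact this.congr_deriv (by ring))
    (fun s hs => (((hd0 p s (hτ.trans_le hs)).sub
      ((hd1 (1 / 2) s (hτ.trans_le hs)).const_mul a)).add
      ((hd0 (1 / 2) s (hτ.trans_le hs)).const_mul b)).continuousAt.continuousWithinAt)
    (fun s hs => (((hd1 p s (hτ.trans_le hs)).const_mul κ).sub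
      ((hd2 (1 / 2) s (hτ.trans_le hs)).const_mul _)).continuousAt.continuousWithinAt)
    (fun s y hs hsL hy => by
      have hs0 : 0 < s := hτ.trans hs
      simp only [hR1 s hs0, hR2 s hs0, hR3 s hs0, hR4 s hs0]
      refine power_barrier_laplace_pos hn2 hp hp0 hκ ha0.le hb1 hs0 (by positivity)
        (by positivity) ?_ (hy_le s y hs hy.le)
      have : s ^ p * s = s ^ (p + 1 / 2) * s ^ (1 / 2 : ℝ) := by
        rw [← Real.rpow_add hs0, ← Real.rpow_add_one hs0.ne']
        ring_nf
      rw [this, hH]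
      gcongr
      linarith)
    (fun s y hs hsL hy => by
      have hs0 : 0 < s := hτ.trans hs
      simp only [hR1 s hs0, hR2 s hs0, hR3 s hs0]
      refine power_barrier_robin_nonpos hn2 hp hp0 hκ hΓ hpΓ ha0.le ?_ hb0.le hs0 hτ hs
        (by positivity) (by positivity) ?_ (hy_le s y hs ?_)
      · refine le_trans ?_ hb2
        gcongr
      · have h1 : s ^ p * τ ≤ τ ^ (p + 1 / 2) * s ^ (1 / 2 : ℝ) := by
          have e1 : s ^ p = s ^ (p - 1 / 2) * s ^ (1 / 2 : ℝ) := by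
            rw [← Real.rpow_add hs0]; ring_nf
          have e2 : τ ^ (p + 1 / 2) = τ ^ (p - 1 / 2) * τ := by
            rw [← Real.rpow_add_one hτ.ne']; ring_nf
          have e3 : s ^ (p - 1 / 2) ≤ τ ^ (p - 1 / 2) :=
            Real.rpow_le_rpow_of_nonpos hτ hs.le (by linarith)
          rw [e1, e2]
          calc _ = s ^ (p - 1 / 2) * (s ^ (1 / 2 : ℝ) * τ) := by ring
            _ ≤ τ ^ (p - 1 / 2) * (s ^ (1 / 2 : ℝ) * τ) := by gcongr
            _ = _ := by ring
        calc _ ≤ K * (τ ^ (p + 1 / 2) * s ^ (1 / 2 : ℝ)) := by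
              refine mul_le_mul (by linarith) h1 (by positivity) hK0.le
          _ = _ := by rw [ha]; ring
      · have : 0 < 2 * c * y := by rw [hy]; linarith
        rw [abs_of_pos (pos_of_mul_pos_right this (by positivity)), hy])
    (fun z hz hz0 hzτ => by
      rw [hzτ]
      have h1 := hw.apply_zero_le hm hμ hγ hΓ hτ hτμ hcτ hz hz0.le
      have hyz : z (Fin.last m) ^ 2 ≤ τ := by
        rw [← hzτ, ← sq_abs]
        exact pow_le_pow_left₀ (abs_nonneg _) (abs_apply_le_norm _ _) 2
      have h2 : a * τ ^ (1 / 2 - 1 : ℝ) = K * τ ^ p := by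
        rw [ha, mul_assoc, ← Real.rpow_add hτ]
        ring_nf
      have h3 : z (Fin.last m) ^ 2 * (κ * τ ^ (p - 1)
          - a * ((n - 1) / 2) * τ ^ (1 / 2 - 2 : ℝ)) ≤ κ * τ ^ p := by
        calc _ ≤ z (Fin.last m) ^ 2 * (κ * τ ^ (p - 1)) := by
              refine mul_le_mul_of_nonneg_left ?_ (sq_nonneg _)
              have : 0 ≤ a * ((n - 1) / 2) * τ ^ (1 / 2 - 2 : ℝ) := by positivity
              linarith
          _ ≤ τ * (κ * τ ^ (p - 1)) := by gcongr
          _ = _ := by rw [hR1 τ hτ]; field_simp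
      have h4 : (1 + κ) * τ ^ p ≤ K * τ ^ p := by
        refine mul_le_mul_of_nonneg_right ?_ (by positivity)
        have : 0 ≤ γ * μ * (p + κ) := by positivity
        linarith
      have h5 : b * τ ^ (1 / 2 : ℝ) ≤ M := by
        have : b * τ ^ (1 / 2 : ℝ) ≤ b * L ^ (1 / 2 : ℝ) := by gcongr
        have : 0 ≤ L ^ p * (1 + κ) := by positivity
        linarith
      rw [h2]
      calc _ ≤ z 0 * M := by
            refine mul_le_mul_of_nonneg_left ?_ hz0.le
            linarith
        _ ≤ M * w z := by rw [mul_comm]; gcongr)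
    (fun y hy => by
      have h3 : y ^ 2 * (κ * L ^ (p - 1)
          - a * ((n - 1) / 2) * L ^ (1 / 2 - 2 : ℝ)) ≤ κ * L ^ p := by
        calc _ ≤ y ^ 2 * (κ * L ^ (p - 1)) := by
              refine mul_le_mul_of_nonneg_left ?_ (sq_nonneg _)
              have : 0 ≤ a * ((n - 1) / 2) * L ^ (1 / 2 - 2 : ℝ) := by positivity
              linarith
          _ ≤ L * (κ * L ^ (p - 1)) := by gcongr
          _ = _ := by rw [hR1 L hL0]; field_simp
      have h4 : 0 ≤ a * L ^ (1 / 2 - 1 : ℝ) := by positivity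
      have h5 : L ^ p * (1 + κ) + b * L ^ (1 / 2 : ℝ) = M := rfl
      linarith)
    hx hx0 hxτ
  refine le_trans ?_ key
  refine mul_le_mul_of_nonneg_left ?_ hx0
  have : 0 ≤ b * (‖x‖ ^ 2) ^ (1 / 2 : ℝ) := by positivity
  simp only [hy0]
  linarith

theorem hasDerivAt_comp_line {k : ℕ} {u : E k → ℝ} {x v : E k} (hu : ContDiffAt ℝ 2 u x) :
    (∀ᶠ t in 𝓝 (0 : ℝ), HasDerivAt (fun t : ℝ => u (x + t • v)) (fderiv ℝ u (x + t • v) v) t) ∧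
    HasDerivAt (fun t : ℝ => fderiv ℝ u (x + t • v) v) (iteratedFDeriv ℝ 2 u x ![v, v]) 0 := by
  have hline : ∀ t : ℝ, HasDerivAt (fun t : ℝ => x + t • v) v t := fun t => by
    simpa using ((hasDerivAt_id t).smul_const v).const_add x
  have hx : x + (0 : ℝ) • v = x := by simp
  constructor
  · have h1 : ∀ᶠ z in 𝓝 (x + (0 : ℝ) • v), ContDiffAt ℝ 2 u z := by
      rw [hx]; exact hu.eventually (by decide)
    filter_upwards [(hline 0).continuousAt.eventually h1] with t ht
    exact (ht.differentiableAt two_ne_zero).hasFDerivAt.comp_hasDerivAt t (hline t)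
  · have h1 : DifferentiableAt ℝ (fderiv ℝ u) x :=
      (hu.fderiv_right (m := 1) (by norm_num)).differentiableAt one_ne_zero
    have h2 : HasDerivAt (fun t : ℝ => fderiv ℝ u (x + t • v)) (fderiv ℝ (fderiv ℝ u) x v) 0 :=
      HasFDerivAt.comp_hasDerivAt_of_eq (0 : ℝ) h1.hasFDerivAt (hline 0) hx.symm
    rw [iteratedFDeriv_two_apply]
    exact ((ContinuousLinearMap.apply ℝ ℝ v).hasFDerivAt).comp_hasDerivAt (0 : ℝ) h2

/-- The reflection `x₁ ↦ -x₁`. -/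
def reflectFirst (m : ℕ) : E (m+1) ≃ₗᵢ[ℝ] E (m+1) :=
  LinearIsometryEquiv.piLpCongrRight 2 fun i =>
    if i = 0 then LinearIsometryEquiv.neg ℝ else LinearIsometryEquiv.refl ℝ ℝ

theorem reflectFirst_apply {m : ℕ} (x : E (m+1)) (i : Fin (m+1)) :
    reflectFirst m x i = if i = 0 then -x i else x i := by
  unfold reflectFirst
  rw [LinearIsometryEquiv.piLpCongrRight_apply]
  split_ifs with h <;> simp [h]

theorem reflectFirst_single_zero {m : ℕ} (a : ℝ) :
    reflectFirst m (EuclideanSpace.single 0 a) = -EuclideanSpace.single 0 a := by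
  ext j
  rw [reflectFirst_apply]
  split_ifs with h <;> simp [h]

theorem reflectFirst_single_of_ne {m : ℕ} {i : Fin (m+1)} (hi : i ≠ 0) (a : ℝ) :
    reflectFirst m (EuclideanSpace.single i a) = EuclideanSpace.single i a := by
  ext j
  rw [reflectFirst_apply]
  split_ifs with h
  · simp [h, hi.symm]
  · rfl

theorem isOddRobinSolution_sub_reflectFirst {m : ℕ} (hm : 1 ≤ m) {μ γ c τ L : ℝ} (hγ : γ ≠ 0)
    {u : E (m+1) → ℝ} (hcont : ContinuousOn u (shell m c τ L))
    (hu : ∀ x : E (m+1), ‖x‖ ^ 2 < L → 2 * c * |x (Fin.last m)| < ‖x‖ ^ 2 + τ →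
      ContDiffAt ℝ 2 u x ∧ elap u x = 0)
    (hrob : ∀ (x : E (m+1)) (σ : ℝ), σ ^ 2 = 1 → 2 * c * (σ * x (Fin.last m)) = ‖x‖ ^ 2 + τ →
      DifferentiableAt ℝ u x ∧
      u x + γ * fderiv ℝ u x (μ • (EuclideanSpace.single (Fin.last m) (σ * c) - x)) = 0)
    (hout : ∀ x : E (m+1), ‖x‖ ^ 2 = L → u x = x 0) :
    IsOddRobinSolution m μ γ c τ L 2 fun x => u x - u (reflectFirst m x) := by
  have hl : Fin.last m ≠ 0 := by
    intro h
    have := congrArg Fin.val h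
    simp at this
    omega
  have hRl : ∀ x : E (m+1), reflectFirst m x (Fin.last m) = x (Fin.last m) := fun x => by
    rw [reflectFirst_apply, if_neg hl]
  have hR0 : ∀ x : E (m+1), reflectFirst m x 0 = -x 0 := fun x => by
    rw [reflectFirst_apply, if_pos rfl]
  have hRn : ∀ x : E (m+1), ‖reflectFirst m x‖ = ‖x‖ := (reflectFirst m).norm_map
  refine ⟨?_, ?_, ?_, ?_, ?_⟩
  · refine hcont.sub (hcont.comp (reflectFirst m).continuous.continuousOn fun x hx => ?_)
    simpa only [shell, mem_ofPred_eq, hRn, hRl] using hx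
  · intro x h1 h2
    obtain ⟨hx, hlx⟩ := hu x h1 h2
    obtain ⟨hRx, hlRx⟩ := hu (reflectFirst m x) (by rwa [hRn]) (by rwa [hRn, hRl])
    refine ⟨fun i => iteratedFDeriv ℝ 2 u x ![EuclideanSpace.single i 1, EuclideanSpace.single i 1]
      - iteratedFDeriv ℝ 2 u (reflectFirst m x)
        ![EuclideanSpace.single i 1, EuclideanSpace.single i 1], ?_, fun i => ?_⟩
    · rw [Finset.sum_sub_distrib]
      exact sub_eq_zero.2 (hlx.trans hlRx.symm)
    · set e : E (m+1) := EuclideanSpace.single i 1 with he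
      have hA := hasDerivAt_comp_line (v := e) hx
      have hB := hasDerivAt_comp_line (v := reflectFirst m e) hRx
      have hD : iteratedFDeriv ℝ 2 u (reflectFirst m x) ![e, e] =
          iteratedFDeriv ℝ 2 u (reflectFirst m x) ![reflectFirst m e, reflectFirst m e] := by
        by_cases hi : i = 0
        · subst hi
          rw [he, reflectFirst_single_zero, iteratedFDeriv_two_apply, iteratedFDeriv_two_apply]
          simp
        · rw [he, reflectFirst_single_of_ne hi]
      refine ⟨fun t => fderiv ℝ u (x + t • e) e -
        fderiv ℝ u (reflectFirst m x + t • reflectFirst m e) (reflectFirst m e), ?_, ?_⟩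
      · filter_upwards [hA.1, hB.1] with t ht1 ht2
        simp only [map_add, map_smul]
        exact ht1.sub ht2
      · beta_reduce
        rw [hD]
        exact hA.2.sub hB.2
  · intro x σ hσ hx
    have key : ∀ z : E (m+1), 2 * c * (σ * z (Fin.last m)) = ‖z‖ ^ 2 + τ →
        HasDerivAt (fun t : ℝ => u (z + t • μ • (z - EuclideanSpace.single (Fin.last m) (σ * c))))
          (u z / γ) 0 := by
      intro z hz
      obtain ⟨hd, hr⟩ := hrob z σ hσ hz
      set b : E (m+1) := EuclideanSpace.single (Fin.last m) (σ * c)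
      have hline : HasDerivAt (fun t : ℝ => z + t • μ • (z - b)) (μ • (z - b)) 0 := by
        simpa using ((hasDerivAt_id (0 : ℝ)).smul_const (μ • (z - b))).const_add z
      have hz0 : z + (0 : ℝ) • μ • (z - b) = z := by simp
      have h := (show HasFDerivAt u (fderiv ℝ u z) (z + (0 : ℝ) • μ • (z - b)) by
        rw [hz0]; exact hd.hasFDerivAt).comp_hasDerivAt (0 : ℝ) hline
      have hv : fderiv ℝ u z (μ • (z - b)) = u z / γ := by
        rw [← neg_sub b z, smul_neg, map_neg, eq_div_iff hγ]
        linarith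
      rw [hv] at h
      exact h
    have h := (key x hx).fun_sub (key (reflectFirst m x) (by rwa [hRn, hRl]))
    rw [← sub_div] at h
    simp only [map_add, map_smul, map_sub, reflectFirst_single_of_ne hl]
    exact h
  · intro x hx
    have : reflectFirst m x = x := by
      ext j
      rw [reflectFirst_apply]
      split_ifs with h
      · rw [h, hx, neg_zero]
      · rfl
    rw [this, sub_self]
  · intro x hx
    rw [hout x hx, hout _ (by rwa [hRn]), hR0]
    ring

theorem shell_subset_closure {m : ℕ} {c τ L : ℝ} (hτ : 0 < τ) (hcτ : τ < c ^ 2) (hL0 : 0 < L)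
    (hL : ∀ (x : E (m+1)) (σ : ℝ), σ ^ 2 = 1 → 2 * c * (σ * x (Fin.last m)) = ‖x‖ ^ 2 + τ →
      ‖x‖ ^ 2 < L) :
    shell m c τ L ⊆
      closure {x : E (m+1) | ‖x‖ ^ 2 < L ∧ 2 * c * |x (Fin.last m)| < ‖x‖ ^ 2 + τ} := by
  intro x hx
  rcases hx.2.lt_or_eq with hint | hbd
  · rcases hx.1.lt_or_eq with hlt | heq
    · exact subset_closure ⟨hlt, hint⟩
    have hline : Continuous fun t : ℝ => (1 - t) • x := by fun_prop
    have hU : IsOpen {z : E (m+1) | 2 * c * |z (Fin.last m)| < ‖z‖ ^ 2 + τ} :=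
      isOpen_lt (by fun_prop) (by fun_prop)
    have hev := hline.continuousAt.preimage_mem_nhds (x := (0 : ℝ))
      (hU.mem_nhds (by simpa using hint))
    have ht : Tendsto (fun t : ℝ => (1 - t) • x) (𝓝[>] 0) (𝓝 x) := by
      simpa using (hline.tendsto 0).mono_left nhdsWithin_le_nhds
    refine mem_closure_of_tendsto ht ?_
    filter_upwards [nhdsWithin_le_nhds hev, Ioo_mem_nhdsGT one_pos] with t h1 h2
    refine ⟨?_, h1⟩
    rw [norm_smul, mul_pow, heq, Real.norm_eq_abs, sq_abs]
    have : (1 - t) ^ 2 < 1 := by nlinarith [h2.1, h2.2]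
    nlinarith
  · obtain ⟨σ, hσ, hσy⟩ : ∃ σ : ℝ, σ ^ 2 = 1 ∧ |x (Fin.last m)| = σ * x (Fin.last m) := by
      rcases abs_choice (x (Fin.last m)) with h | h
      · exact ⟨1, by norm_num, by rw [one_mul, h]⟩
      · exact ⟨-1, by norm_num, by rw [h]; ring⟩
    rw [hσy] at hbd
    set b : E (m+1) := EuclideanSpace.single (Fin.last m) (σ * c) with hb
    have hline : Continuous fun t : ℝ => x + t • (1 : ℝ) • (x - b) := by fun_prop
    have hU : IsOpen {z : E (m+1) | ‖z‖ ^ 2 < L ∧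
        2 * c * (-σ * z (Fin.last m)) < ‖z‖ ^ 2 + τ} := by
      apply IsOpen.and <;> exact isOpen_lt (by fun_prop) (by fun_prop)
    have hev := hline.continuousAt.preimage_mem_nhds (x := (0 : ℝ))
      (hU.mem_nhds (by
        simp only [zero_smul, add_zero]
        exact ⟨hL x σ hσ hbd, by nlinarith [sq_nonneg ‖x‖]⟩))
    have ht : Tendsto (fun t : ℝ => x + t • (1 : ℝ) • (x - b)) (𝓝[>] 0) (𝓝 x) := by
      simpa using (hline.tendsto 0).mono_left nhdsWithin_le_nhds
    refine mem_closure_of_tendsto ht ?_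
    filter_upwards [nhdsWithin_le_nhds hev, self_mem_nhdsWithin] with t ht ht0
    have ht0 : 0 < t := ht0
    obtain ⟨h0, h1⟩ := ht
    refine ⟨h0, ?_⟩
    have h2 : 2 * c * (σ * (x + t • (1 : ℝ) • (x - b)) (Fin.last m)) <
        ‖x + t • (1 : ℝ) • (x - b)‖ ^ 2 + τ := by
      have hvy : (x + t • (1 : ℝ) • (x - b)) (Fin.last m) =
          x (Fin.last m) + (x (Fin.last m) - σ * c) * t := by
        simp [hb]
        ring
      rw [norm_add_smul_sub_single_sq, hvy]
      have : 0 < (c ^ 2 - τ) * (2 * t + t ^ 2) := mul_pos (by linarith) (by positivity)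
      linear_combination this + (1 + 2 * t + t ^ 2) * hbd - c ^ 2 * (2 * t + t ^ 2) * hσ
    beta_reduce at h1
    generalize (x + t • (1 : ℝ) • (x - b)) = z at h1 h2 ⊢
    have h3 : |z (Fin.last m)| = σ * z (Fin.last m) ∨ |z (Fin.last m)| = -σ * z (Fin.last m) := by
      rcases (show σ = 1 ∨ σ = -1 by simpa using hσ) with rfl | rfl
      · rw [neg_mul, one_mul]; exact abs_choice _
      · rw [neg_neg, neg_mul, one_mul]; exact (abs_choice _).symm
    rcases h3 with h3 | h3 <;> rw [h3]
    · exact h2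
    · exact h1

theorem exists_fderiv_single_zero_eq {m : ℕ} {u : E (m+1) → ℝ} {r : ℝ} (hr : 0 < r)
    (hu : ∀ t : ℝ, |t| ≤ r → DifferentiableAt ℝ u (EuclideanSpace.single 0 t)) :
    ∃ t : ℝ, |t| < r ∧ u (EuclideanSpace.single 0 r) - u (EuclideanSpace.single 0 (-r)) =
      fderiv ℝ u (EuclideanSpace.single 0 t) (EuclideanSpace.single 0 1) * (2 * r) := by
  have hd : ∀ t : ℝ, |t| ≤ r → HasDerivAt (fun t : ℝ => u (EuclideanSpace.single 0 t))
      (fderiv ℝ u (EuclideanSpace.single 0 t) (EuclideanSpace.single 0 1)) t := by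
    intro t ht
    have hl : HasDerivAt (fun t : ℝ => (EuclideanSpace.single 0 t : E (m+1)))
        (EuclideanSpace.single 0 1) t := by
      have h := (hasDerivAt_id t).smul_const (EuclideanSpace.single 0 1 : E (m+1))
      have he : ∀ s : ℝ, s • (EuclideanSpace.single 0 1 : E (m+1)) = EuclideanSpace.single 0 s := by
        intro s
        ext j
        simp
      simpa [he] using h
    exact (hu t ht).hasFDerivAt.comp_hasDerivAt t hl
  obtain ⟨t, ht, h⟩ := exists_hasDerivAt_eq_slope _ _ (neg_lt_self hr)
    (fun t ht => (hd t (abs_le.2 ht)).continuousAt.continuousWithinAt)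
    (fun t ht => hd t (abs_le.2 ⟨ht.1.le, ht.2.le⟩))
  refine ⟨t, abs_lt.2 ht, ?_⟩
  rw [h]
  field_simp
  ring

theorem exponent_properties {m : ℕ} (hm : 1 ≤ m) {Γ p : ℝ} (hΓ : 1 < Γ)
    (hp : p = ((-(m:ℝ) + Real.sqrt ((m:ℝ)^2 + 4*((m:ℝ) - 1 + 2/Γ)))/2 - 1)/2) :
    -1/2 < p ∧ p < 0 ∧ Γ * (1 + ((m:ℝ) + 1 + 1) * p + 2 * p ^ 2) = 1 := by
  have hm' : (1 : ℝ) ≤ m := by exact_mod_cast hm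
  have h0 : 0 < 2 / Γ := by positivity
  have h1 : 2 / Γ < 2 := by rw [div_lt_iff₀ (by linarith)]; linarith
  have hlo : (m : ℝ) < Real.sqrt ((m:ℝ)^2 + 4*((m:ℝ) - 1 + 2/Γ)) :=
    Real.lt_sqrt_of_sq_lt (by linarith)
  have hhi : Real.sqrt ((m:ℝ)^2 + 4*((m:ℝ) - 1 + 2/Γ)) < m + 2 := by
    rw [Real.sqrt_lt' (by linarith)]
    linarith
  have hsq := Real.sq_sqrt (show 0 ≤ (m:ℝ)^2 + 4*((m:ℝ) - 1 + 2/Γ) by nlinarith)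
  refine ⟨by linarith, by linarith, ?_⟩
  have : 1 + ((m:ℝ) + 1 + 1) * p + 2 * p ^ 2 = 1 / Γ := by
    rw [hp]
    have : 2 / Γ = 2 * (1 / Γ) := by ring
    linear_combination hsq / 8 + this / 2
  rw [this]
  field_simp

theorem exists_lower_bound_on_axis {m : ℕ} (hm : 1 ≤ m) {μ γ p : ℝ} (hμ : 0 < μ)
    (hΓ : 1 < γ * μ) (hp : -1 / 2 < p) (hp0 : p < 0)
    (hpΓ : γ * μ * (1 + ((m : ℝ) + 1 + 1) * p + 2 * p ^ 2) = 1) :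
    ∃ c C : ℝ, 0 < c ∧ 0 < C ∧ ∀ ε ∈ Ioo (0 : ℝ) (1 / (4 * μ)), ∀ w : E (m+1) → ℝ,
      IsOddRobinSolution m μ γ (1 / μ + ε / 2) (ε / μ + ε ^ 2 / 4) (25 / μ ^ 2) 2 w →
      ∃ r : ℝ, 0 < r ∧ r < c * Real.sqrt ε ∧ r ^ 2 < 25 / μ ^ 2 ∧
        1 / C * ε ^ p * (2 * r) ≤ w (EuclideanSpace.single 0 r) := by
  have hγ : 0 < γ := pos_of_mul_pos_left (zero_lt_one.trans hΓ) hμ.le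
  have hl : Fin.last m ≠ 0 := by
    intro h
    have := congrArg Fin.val h
    simp at this
    omega
  obtain ⟨M, K, hM, hK, hMK⟩ := exists_power_lower_bound hm hμ hΓ hp hp0 hpΓ
  obtain ⟨R, hR1, hRK⟩ : ∃ R : ℝ, 1 ≤ R ∧ R ^ (p + 1 / 2) = K + 1 := by
    have hq : 0 < p + 1 / 2 := by linarith
    refine ⟨(K + 1) ^ (1 / (p + 1 / 2)), Real.one_le_rpow (by linarith) (by positivity), ?_⟩
    rw [← Real.rpow_mul (by positivity), one_div_mul_cancel hq.ne', Real.rpow_one]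
  have hR0 : 0 < R := by linarith
  set ε₀ : ℝ := 25 / μ / (2 * R) with hε₀
  have hε₀0 : 0 < ε₀ := by positivity
  set C₁ : ℝ := 2 * M * Real.sqrt R / (2 / μ) ^ p with hC₁
  have hC₁0 : 0 < C₁ := by positivity
  refine ⟨Real.sqrt (2 * R / μ) + 1, C₁ + 2 * ε₀ ^ p, by positivity, by positivity, ?_⟩
  intro ε ⟨hε, hεμ⟩ w hw
  set τ : ℝ := ε / μ + ε ^ 2 / 4 with hτ
  have hτ0 : 0 < τ := by positivity
  have hτε : τ ≤ 2 * ε / μ := by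
    have h1 : ε ≤ 1 / μ := hεμ.le.trans (by gcongr; linarith)
    have h2 : ε * ε ≤ ε * (1 / μ) := by gcongr
    have h3 : ε * (1 / μ) = ε / μ := by ring
    have h4 : 2 * ε / μ = ε / μ + ε / μ := by ring
    have h5 : 0 < ε / μ := by positivity
    nlinarith
  have hτμ : τ ≤ 1 / μ ^ 2 := by
    refine hτε.trans ?_
    calc 2 * ε / μ ≤ 2 * (1 / (4 * μ)) / μ := by gcongr
      _ = 1 / 2 * (1 / μ ^ 2) := by field_simp; norm_num
      _ ≤ 1 / μ ^ 2 := by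
        have : 0 < 1 / μ ^ 2 := by positivity
        linarith
  have hc : 1 / μ ≤ 1 / μ + ε / 2 := by linarith
  have hcτ : τ ≤ (1 / μ + ε / 2) ^ 2 := by
    have : (1 / μ + ε / 2) ^ 2 = 1 / μ ^ 2 + τ := by rw [hτ]; field_simp; ring
    have h2 : 0 < 1 / μ ^ 2 := by positivity
    linarith
  have hrad : ∀ S : ℝ, 0 ≤ S → S ≤ R →
      Real.sqrt (S * τ) < (Real.sqrt (2 * R / μ) + 1) * Real.sqrt ε := by
    intro S hS0 hS
    have h1 : Real.sqrt (S * τ) ≤ Real.sqrt (2 * R / μ) * Real.sqrt ε := by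
      rw [← Real.sqrt_mul (by positivity)]
      refine Real.sqrt_le_sqrt ?_
      calc S * τ ≤ R * (2 * ε / μ) := by gcongr
        _ = 2 * R / μ * ε := by ring
    have h2 : 0 < Real.sqrt ε := Real.sqrt_pos.2 hε
    linarith
  have hmem : ∀ r : ℝ, r ^ 2 < 25 / μ ^ 2 → EuclideanSpace.single 0 r ∈
      shell m (1 / μ + ε / 2) τ (25 / μ ^ 2) := by
    intro r hr
    simp only [shell, mem_ofPred_eq, PiLp.norm_single, Real.norm_eq_abs, sq_abs,
      PiLp.single_apply, if_neg hl, abs_zero, mul_zero]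
    exact ⟨hr.le, by positivity⟩
  rcases lt_or_ge (R * τ) (25 / μ ^ 2) with hcase | hcase
  · set r : ℝ := Real.sqrt (R * τ) with hr
    have hr0 : 0 < r := Real.sqrt_pos.2 (by positivity)
    have hr2 : r ^ 2 = R * τ := Real.sq_sqrt (by positivity)
    refine ⟨r, hr0, hrad R hR0.le le_rfl, by rwa [hr2], ?_⟩
    have h := hMK _ τ hc hτ0 hτμ w hw _ (hmem r (by rwa [hr2])) (by simpa using hr0.le)
      (by simp [hl]) (by
        rw [PiLp.norm_single, Real.norm_eq_abs, sq_abs, hr2]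
        nlinarith)
    rw [PiLp.norm_single, Real.norm_eq_abs, sq_abs, PiLp.single_apply, if_pos rfl] at h
    have h1 : r * (r ^ 2) ^ p = R ^ (p + 1 / 2) * τ ^ (p + 1 / 2) := by
      rw [← Real.mul_rpow hR0.le hτ0.le, ← hr2, Real.rpow_add (by positivity),
        ← Real.sqrt_eq_rpow, Real.sqrt_sq hr0.le, mul_comm]
    have h2 : r * (r ^ 2) ^ (1 / 2 - 1 : ℝ) = 1 := by
      rw [Real.rpow_sub (by positivity), ← Real.sqrt_eq_rpow, Real.sqrt_sq hr0.le, Real.rpow_one]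
      field_simp
    have h3 : τ ^ (p + 1 / 2) ≤ M * w (EuclideanSpace.single 0 r) := by
      refine le_trans (le_of_eq ?_) h
      rw [mul_sub, h1, hRK]
      linear_combination K * τ ^ (p + 1 / 2) * h2
    have h4 : τ ^ (p + 1 / 2) = τ ^ p * (r / Real.sqrt R) := by
      rw [Real.rpow_add hτ0, ← Real.sqrt_eq_rpow, hr, Real.sqrt_mul hR0.le]
      field_simp
    have h5 : (2 / μ) ^ p * ε ^ p ≤ τ ^ p := by
      rw [← Real.mul_rpow (by positivity) hε.le]
      refine Real.rpow_le_rpow_of_nonpos hτ0 ?_ hp0.le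
      calc τ ≤ 2 * ε / μ := hτε
        _ = 2 / μ * ε := by ring
    calc 1 / (C₁ + 2 * ε₀ ^ p) * ε ^ p * (2 * r) ≤ 1 / C₁ * ε ^ p * (2 * r) := by
          gcongr
          have : 0 < ε₀ ^ p := by positivity
          linarith
      _ = (2 / μ) ^ p * ε ^ p * (r / Real.sqrt R) / M := by
          rw [hC₁]
          field_simp
      _ ≤ τ ^ p * (r / Real.sqrt R) / M := by gcongr
      _ ≤ w (EuclideanSpace.single 0 r) := by
          rw [← h4, div_le_iff₀ hM, mul_comm]
          exact h3
  · set r : ℝ := Real.sqrt (1 * τ) with hr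
    have hr0 : 0 < r := Real.sqrt_pos.2 (by positivity)
    have hr2 : r ^ 2 = 1 * τ := Real.sq_sqrt (by positivity)
    have hrL : r ^ 2 < 25 / μ ^ 2 := by
      rw [hr2, one_mul]
      exact hτμ.trans_lt (by gcongr; norm_num)
    refine ⟨r, hr0, hrad 1 zero_le_one hR1, hrL, ?_⟩
    have h := hw.apply_zero_le hm hμ hγ hΓ hτ0 hτμ hcτ (hmem r hrL) (by simpa using hr0.le)
    rw [PiLp.single_apply, if_pos rfl] at h
    refine le_trans ?_ h
    have h1 : ε ^ p ≤ ε₀ ^ p := by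
      refine Real.rpow_le_rpow_of_nonpos hε₀0 ?_ hp0.le
      have : 25 / μ ^ 2 ≤ R * (2 * ε / μ) := hcase.trans (by gcongr)
      rw [hε₀, div_le_iff₀ (by positivity)]
      calc 25 / μ = 25 / μ ^ 2 * μ := by field_simp
        _ ≤ R * (2 * ε / μ) * μ := by gcongr
        _ = ε * (2 * R) := by field_simp
    have h2 : 1 / (C₁ + 2 * ε₀ ^ p) * ε ^ p * 2 ≤ 1 := by
      rw [div_mul_eq_mul_div, div_mul_eq_mul_div, div_le_one (by positivity)]
      linarith
    calc 1 / (C₁ + 2 * ε₀ ^ p) * ε ^ p * (2 * r) = 1 / (C₁ + 2 * ε₀ ^ p) * ε ^ p * 2 * r := by ring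
      _ ≤ 1 * r := by gcongr
      _ = r := one_mul r

theorem eglue_zero_eq_single {m : ℕ} (t : ℝ) :
    eglue (0 : E m) t = EuclideanSpace.single (Fin.last m) t := by
  ext j
  refine Fin.lastCases ?_ (fun i => ?_) j
  · simp [eglue]
  · simp [eglue, (Fin.castSucc_lt_last i).ne]

theorem mem_closedBall_single_iff {k : ℕ} {μ c τ σ : ℝ} (hμ : 0 < μ) (hτ : c ^ 2 = 1 / μ ^ 2 + τ)
    (hσ : σ ^ 2 = 1) (i : Fin k) (x : E k) :
    x ∈ closedBall (EuclideanSpace.single i (σ * c)) (1 / μ) ↔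
      ‖x‖ ^ 2 + τ ≤ 2 * c * (σ * x i) := by
  rw [mem_closedBall, dist_eq_norm, ← pow_le_pow_iff_left₀ (norm_nonneg _) (by positivity)
    two_ne_zero, norm_sub_single_sq, one_div_pow, mul_pow, hσ, hτ]
  constructor <;> intro h <;> linarith

theorem mem_sphere_single_iff {k : ℕ} {μ c τ σ : ℝ} (hμ : 0 < μ) (hτ : c ^ 2 = 1 / μ ^ 2 + τ)
    (hσ : σ ^ 2 = 1) (i : Fin k) (x : E k) :
    x ∈ sphere (EuclideanSpace.single i (σ * c)) (1 / μ) ↔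
      2 * c * (σ * x i) = ‖x‖ ^ 2 + τ := by
  rw [mem_sphere, dist_eq_norm, ← pow_left_inj₀ (norm_nonneg _) (by positivity)
    two_ne_zero, norm_sub_single_sq, one_div_pow, mul_pow, hσ, hτ]
  constructor <;> intro h <;> linarith

theorem ball_diff_closedBalls_eq {m : ℕ} {μ c τ : ℝ} (hμ : 0 < μ) (hc : 0 ≤ c)
    (hτ : c ^ 2 = 1 / μ ^ 2 + τ) :
    ball (0 : E (m+1)) (5 / μ) \ (closedBall (EuclideanSpace.single (Fin.last m) (1 * c)) (1 / μ) ∪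
      closedBall (EuclideanSpace.single (Fin.last m) (-1 * c)) (1 / μ)) =
    {x : E (m+1) | ‖x‖ ^ 2 < 25 / μ ^ 2 ∧ 2 * c * |x (Fin.last m)| < ‖x‖ ^ 2 + τ} := by
  ext x
  have h25 : 25 / μ ^ 2 = (5 / μ) ^ 2 := by ring
  rw [Set.mem_sdiff, mem_union, mem_closedBall_single_iff hμ hτ (by norm_num),
    mem_closedBall_single_iff hμ hτ (by norm_num), mem_ball_zero_iff, not_or, not_le, not_le,
    mem_ofPred_eq, h25, pow_lt_pow_iff_left₀ (norm_nonneg _) (by positivity) two_ne_zero]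
  refine and_congr_right fun _ => ⟨fun h => ?_, fun h => ⟨?_, ?_⟩⟩
  · rcases abs_choice (x (Fin.last m)) with h' | h' <;> rw [h'] <;> linarith [h.1, h.2]
  · exact (mul_le_mul_of_nonneg_left (by rw [one_mul]; exact le_abs_self _)
      (by positivity)).trans_lt h
  · exact (mul_le_mul_of_nonneg_left (by rw [neg_one_mul]; exact neg_le_abs _)
      (by positivity)).trans_lt h

theorem norm_epre_single_zero_le {m : ℕ} (t : ℝ) :
    ‖epre (EuclideanSpace.single 0 t : E (m+1))‖ ≤ |t| := by
  have h : ‖epre (EuclideanSpace.single 0 t : E (m+1))‖ ^ 2 ≤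
      ‖(EuclideanSpace.single 0 t : E (m+1))‖ ^ 2 := by
    rw [EuclideanSpace.real_norm_sq_eq, EuclideanSpace.real_norm_sq_eq, Fin.sum_univ_castSucc]
    exact le_add_of_nonneg_right (sq_nonneg _)
  rw [← Real.norm_eq_abs, ← PiLp.norm_single 2 (fun _ : Fin (m+1) => ℝ) 0 t]
  exact le_of_sq_le_sq h (norm_nonneg _)

/-- Theorem 1.7 (optimal lower bound on the gradient for `γ > 1/μ`). -/
theorem gradient_lower_bound (m : ℕ) (hm : 1 ≤ m) (γ μ : ℝ) (hμ : 0 < μ) (hγ : 1/μ < γ) :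
    ∃ c C : ℝ, 0 < c ∧ 0 < C ∧
      ∀ ε ∈ Set.Ioo (0:ℝ) (1/(4*μ)),
      -- the geometry
      ∀ u : E (m+1) → ℝ,
      (fun Om D1c D2c Omt =>
        -- Ω̃ := Ω \ (closure D1 ∪ closure D2)
        ContinuousOn u (closure Omt) ∧
        ContDiffOn ℝ 2 u Omt ∧
        (∀ x ∈ Omt, elap u x = 0) ∧
        (∀ x ∈ Omt ∪ sphere D1c (1/μ) ∪ sphere D2c (1/μ), DifferentiableAt ℝ u x) ∧
        ContinuousOn (fun x => gradient u x) (Omt ∪ sphere D1c (1/μ) ∪ sphere D2c (1/μ)) ∧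
        -- Robin condition `u + γ ∂_ν u = 0` on the two spheres, `ν(x) = μ (c_j - x)`
        (∀ x ∈ sphere D1c (1/μ), u x + γ * ⟪μ • (D1c - x), gradient u x⟫ = 0) ∧
        (∀ x ∈ sphere D2c (1/μ), u x + γ * ⟪μ • (D2c - x), gradient u x⟫ = 0) ∧
        -- zero flux
        (∫ x in sphere D1c (1/μ), ⟪μ • (D1c - x), gradient u x⟫ ∂(μH[(m:ℝ)]) = 0) ∧
        (∫ x in sphere D2c (1/μ), ⟪μ • (D2c - x), gradient u x⟫ ∂(μH[(m:ℝ)]) = 0) ∧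
        -- boundary data φ(x) = x₁ on ∂Ω
        (∀ x ∈ sphere (0 : E (m+1)) (5/μ), u x = x 0))
        (ball (0 : E (m+1)) (5/μ))
        (eglue (0 : E m) (1/μ + ε/2))
        (eglue (0 : E m) (-(1/μ) - ε/2))
        (ball (0 : E (m+1)) (5/μ) \
          (closedBall (eglue (0 : E m) (1/μ + ε/2)) (1/μ) ∪
           closedBall (eglue (0 : E m) (-(1/μ) - ε/2)) (1/μ))) →
      -- conclusion: the gradient is at least ε^{(α-1)/2}/C somewhere in the neck Ω_{c√ε}
      ∃ x ∈ (ball (0 : E (m+1)) (5/μ) \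
          (closedBall (eglue (0 : E m) (1/μ + ε/2)) (1/μ) ∪
           closedBall (eglue (0 : E m) (-(1/μ) - ε/2)) (1/μ))) ∩
          {x : E (m+1) | ‖epre x‖ < c * Real.sqrt ε ∧
            |lastC x| < ε/2 + 1/μ - Real.sqrt (max (1/μ^2 - ‖epre x‖^2) 0)},
        (1/C) * ε ^ (((-(m:ℝ) + Real.sqrt ((m:ℝ)^2 + 4*((m:ℝ) - 1 + 2/(μ*γ))))/2 - 1)/2)
          ≤ ‖gradient u x‖ := by
  have hΓ : 1 < γ * μ := (div_lt_iff₀ hμ).1 hγ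
  have hγ0 : 0 < γ := (by positivity : 0 < 1 / μ).trans hγ
  have hl : Fin.last m ≠ 0 := by
    intro h
    have := congrArg Fin.val h
    simp at this
    omega
  obtain ⟨hp, hp0, hpΓ⟩ := exponent_properties hm (mul_comm γ μ ▸ hΓ) rfl
  generalize ((-(m:ℝ) + Real.sqrt ((m:ℝ)^2 + 4*((m:ℝ) - 1 + 2/(μ*γ))))/2 - 1)/2 = p at *
  obtain ⟨c, C, hc, hC, hcC⟩ := exists_lower_bound_on_axis hm hμ hΓ hp hp0
    (by rwa [mul_comm γ μ])
  refine ⟨c, C, hc, hC, fun ε hε u hu => ?_⟩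
  have hcen : -(1 / μ) - ε / 2 = -1 * (1 / μ + ε / 2) := by ring
  rw [eglue_zero_eq_single, eglue_zero_eq_single, hcen,
    show EuclideanSpace.single (Fin.last m) (1 / μ + ε / 2) =
      EuclideanSpace.single (Fin.last m) (1 * (1 / μ + ε / 2)) by rw [one_mul]] at hu ⊢
  obtain ⟨hε0, hεμ⟩ := hε
  have hk0 : 0 < 1 / μ + ε / 2 := by positivity
  have hkτ : (1 / μ + ε / 2) ^ 2 = 1 / μ ^ 2 + (ε / μ + ε ^ 2 / 4) := by field_simp; ring
  have hk3 : 1 / μ + ε / 2 < 3 / μ := by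
    have h1 : 1 / (4 * μ) = 1 / 4 * (1 / μ) := by field_simp
    have h2 : 3 / μ = 3 * (1 / μ) := by ring
    have h3 : 0 < 1 / μ := by positivity
    linarith
  have hL0 : 0 < 25 / μ ^ 2 := by positivity
  have hμ2 : 0 < 1 / μ ^ 2 := by positivity
  have hτ0 : 0 < ε / μ + ε ^ 2 / 4 := by positivity
  have hset := ball_diff_closedBalls_eq (m := m) hμ hk0.le hkτ
  rw [hset] at hu ⊢
  specialize hcC ε ⟨hε0, hεμ⟩
  have hs1 := fun x => mem_sphere_single_iff hμ hkτ (σ := 1) (by norm_num) (Fin.last m) x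
  have hs2 := fun x => mem_sphere_single_iff hμ hkτ (σ := -1) (by norm_num) (Fin.last m) x
  clear hset
  generalize 1 / μ + ε / 2 = k at *
  generalize ε / μ + ε ^ 2 / 4 = τ at *
  obtain ⟨hcont, hC2, hlap, hdiff, -, hrob1, hrob2, -, -, hout⟩ := hu
  have hopen : IsOpen {x : E (m+1) | ‖x‖ ^ 2 < 25 / μ ^ 2 ∧
      2 * k * |x (Fin.last m)| < ‖x‖ ^ 2 + τ} := by
    apply IsOpen.and <;> exact isOpen_lt (by fun_prop) (by fun_prop)
  have hw : IsOddRobinSolution m μ γ k τ (25 / μ ^ 2) 2 fun x => u x - u (reflectFirst m x) := by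
    refine isOddRobinSolution_sub_reflectFirst hm hγ0.ne' (hcont.mono ?_) ?_ ?_ ?_
    · exact shell_subset_closure hτ0 (by linarith) hL0 fun x σ hσ hx =>
        norm_sq_lt_of_mem_sphere hμ hk0 hk3 (by linarith) hσ hx
    · exact fun x h1 h2 => ⟨hC2.contDiffAt (hopen.mem_nhds ⟨h1, h2⟩), hlap x ⟨h1, h2⟩⟩
    · intro x σ hσ hx
      rcases (show σ = 1 ∨ σ = -1 by simpa using hσ) with rfl | rfl
      · have hx' := (hs1 x).2 hx
        refine ⟨hdiff x (Or.inl (Or.inr hx')), ?_⟩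
        simpa [inner_gradient_right] using hrob1 x hx'
      · have hx' := (hs2 x).2 hx
        refine ⟨hdiff x (Or.inr hx'), ?_⟩
        simpa [inner_gradient_right] using hrob2 x hx'
    · intro x hx
      refine hout x (mem_sphere_zero_iff_norm.2 ?_)
      rw [← pow_left_inj₀ (norm_nonneg _) (by positivity) two_ne_zero, hx]
      ring
  obtain ⟨r, hr0, hrc, hrL, hwr⟩ := hcC _ hw
  rw [reflectFirst_single_zero, ← PiLp.single_neg] at hwr
  have hmem : ∀ t : ℝ, |t| ≤ r → EuclideanSpace.single 0 t ∈ {x : E (m+1) | ‖x‖ ^ 2 < 25 / μ ^ 2 ∧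
      2 * k * |x (Fin.last m)| < ‖x‖ ^ 2 + τ} := by
    intro t ht
    simp only [mem_ofPred_eq, PiLp.norm_single, Real.norm_eq_abs, PiLp.single_apply, if_neg hl,
      abs_zero, mul_zero]
    exact ⟨(pow_le_pow_left₀ (abs_nonneg t) ht 2).trans_lt hrL, by positivity⟩
  obtain ⟨t, ht, hut⟩ := exists_fderiv_single_zero_eq hr0 fun t ht =>
    hdiff _ (Or.inl (Or.inl (hmem t ht)))
  refine ⟨EuclideanSpace.single 0 t, ⟨hmem t ht.le, ?_, ?_⟩, ?_⟩
  · exact (norm_epre_single_zero_le t).trans_lt (ht.trans hrc)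
  · have h1 : Real.sqrt (max (1 / μ ^ 2 - ‖epre (EuclideanSpace.single 0 t : E (m+1))‖ ^ 2) 0) ≤
        1 / μ := by
      refine Real.sqrt_le_iff.2 ⟨by positivity, max_le ?_ (by positivity)⟩
      rw [one_div_pow]
      linarith [sq_nonneg ‖epre (EuclideanSpace.single 0 t : E (m+1))‖]
    have h2 : lastC (EuclideanSpace.single 0 t : E (m+1)) = 0 := by simp [lastC, hl]
    rw [h2, abs_zero]
    linarith
  · rw [hut] at hwr
    refine (le_of_mul_le_mul_right hwr (by positivity)).trans ?_
    have h1 : fderiv ℝ u (EuclideanSpace.single 0 t) (EuclideanSpace.single 0 1) =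
        ⟪EuclideanSpace.single 0 1, gradient u (EuclideanSpace.single 0 t)⟫ := by
      simp [inner_gradient_right]
    rw [h1]
    refine (real_inner_le_norm _ _).trans ?_
    rw [PiLp.norm_single, norm_one, one_mul]
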